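/- For every n ≥ 0, the quotient of the Clifford group Clifford(n) by its subgroup of scalar matrices {ωᵏ·I : 0 ≤ k < 8} is isomorphic to the group of automorphisms of the Pauli group Pauli(n) that fix all scalars, via the map sending (the class of) C to the automorphism P ↦ C P C⁻¹. -/

import Mathlib

open scoped Matrix Kronecker

noncomputable section

def PX : Matrix (Fin 2) (Fin 2) ℂ := !![0, 1; 1, 0]
def PY : Matrix (Fin 2) (Fin 2) ℂ := !![0, -Complex.I; Complex.I, 0]
def PZ : Matrix (Fin 2) (Fin 2) ℂ := !![1, 0; 0, -1]
def gH : Matrix (Fin 2) (Fin 2) ℂ := (Real.sqrt 2 : ℂ)⁻¹ • !![1, 1; 1, -1]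
def gS : Matrix (Fin 2) (Fin 2) ℂ := !![1, 0; 0, Complex.I]
def gCZ : Matrix (Fin 4) (Fin 4) ℂ :=
  !![1,0,0,0; 0,1,0,0; 0,0,1,0; 0,0,0,-1]
def ω : ℂ := Complex.exp (Complex.I * Real.pi / 4)

/-- Kronecker product of square matrices, with index types flattened to `Fin (m * k)`. -/
def kron' {m k : ℕ} (A : Matrix (Fin m) (Fin m) ℂ) (B : Matrix (Fin k) (Fin k) ℂ) :
    Matrix (Fin (m * k)) (Fin (m * k)) ℂ :=
  Matrix.reindex finProdFinEquiv finProdFinEquiv (A ⊗ₖ B)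

/-- `n`-fold tensor product `P 0 ⊗ P 1 ⊗ ⋯ ⊗ P (n-1)` of 2×2 matrices. -/
def tensorPow : (n : ℕ) → (Fin n → Matrix (Fin 2) (Fin 2) ℂ) →
    Matrix (Fin (2 ^ n)) (Fin (2 ^ n)) ℂ
  | 0, _ => 1
  | n + 1, P =>
      Matrix.reindex (finCongr (pow_succ' 2 n).symm) (finCongr (pow_succ' 2 n).symm)
        (kron' (P 0) (tensorPow n fun i => P i.succ))

/-- The set of n-qubit Pauli operators: λ • P₁ ⊗ ⋯ ⊗ Pₙ with λ ∈ {1,-1,i,-i},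
    Pⱼ ∈ {I, X, Y, Z}. -/
def PauliSet (n : ℕ) : Set (Matrix (Fin (2 ^ n)) (Fin (2 ^ n)) ℂ) :=
  {M | ∃ (lam : ℂ) (P : Fin n → Matrix (Fin 2) (Fin 2) ℂ),
    lam ∈ ({1, -1, Complex.I, -Complex.I} : Set ℂ) ∧
    (∀ i, P i ∈ ({1, PX, PY, PZ} : Set (Matrix (Fin 2) (Fin 2) ℂ))) ∧
    M = lam • tensorPow n P}

/-- `I_{2^a} ⊗ G ⊗ I_{2^b}`, where `G` acts on `c` qubits and `a + c + b = n`. -/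
def embed (a c b n : ℕ) (h : a + c + b = n)
    (G : Matrix (Fin (2 ^ c)) (Fin (2 ^ c)) ℂ) :
    Matrix (Fin (2 ^ n)) (Fin (2 ^ n)) ℂ :=
  Matrix.reindex (finCongr (by subst h; rw [pow_add, pow_add, mul_assoc]))
    (finCongr (by subst h; rw [pow_add, pow_add, mul_assoc]))
    (kron' (1 : Matrix (Fin (2 ^ a)) (Fin (2 ^ a)) ℂ)
      (kron' G (1 : Matrix (Fin (2 ^ b)) (Fin (2 ^ b)) ℂ)))

/-- Generators of the Clifford group: ω•I, and H, S, CZ applied to (adjacent) qubits. -/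
def CliffordGenSet (n : ℕ) : Set (Matrix (Fin (2 ^ n)) (Fin (2 ^ n)) ℂ) :=
  {ω • 1} ∪
  {M | ∃ a b, ∃ h : a + 1 + b = n, M = embed a 1 b n h gH ∨ M = embed a 1 b n h gS} ∪
  {M | ∃ a b, ∃ h : a + 2 + b = n, M = embed a 2 b n h gCZ}

/-- The Clifford group on n qubits, as a subgroup of `GL (2^n) ℂ`. -/
def CliffordGroup (n : ℕ) : Subgroup (GL (Fin (2 ^ n)) ℂ) :=
  Subgroup.closure
    {u : GL (Fin (2 ^ n)) ℂ | (u : Matrix (Fin (2 ^ n)) (Fin (2 ^ n)) ℂ) ∈ CliffordGenSet n}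

/-- The Pauli group on n qubits, as a subgroup of `GL (2^n) ℂ`.
    (Its underlying set of matrices is exactly `PauliSet n`.) -/
def PauliGroup (n : ℕ) : Subgroup (GL (Fin (2 ^ n)) ℂ) :=
  Subgroup.closure
    {u : GL (Fin (2 ^ n)) ℂ | (u : Matrix (Fin (2 ^ n)) (Fin (2 ^ n)) ℂ) ∈ PauliSet n}

/-- Z on the first qubit, identity elsewhere. -/
def ZFirst (n : ℕ) : Matrix (Fin (2 ^ n)) (Fin (2 ^ n)) ℂ :=
  tensorPow n fun i => if i.val = 0 then PZ else 1

/-- Z on the last qubit, identity elsewhere. -/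
def ZLast (n : ℕ) : Matrix (Fin (2 ^ n)) (Fin (2 ^ n)) ℂ :=
  tensorPow n fun i => if i.val = n - 1 then PZ else 1

/-- X on the last qubit, identity elsewhere. -/
def XLast (n : ℕ) : Matrix (Fin (2 ^ n)) (Fin (2 ^ n)) ℂ :=
  tensorPow n fun i => if i.val = n - 1 then PX else 1

/-- The subgroup of scalar matrices {ωᵏ·I : 0 ≤ k < 8} inside the Clifford group,
i.e. the subgroup generated by ω·I. -/
def CliffordScalars (n : ℕ) : Subgroup (CliffordGroup n) :=
  Subgroup.closure
    {x : CliffordGroup n |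
      ((x : GL (Fin (2 ^ n)) ℂ) : Matrix (Fin (2 ^ n)) (Fin (2 ^ n)) ℂ)
        = ω • (1 : Matrix (Fin (2 ^ n)) (Fin (2 ^ n)) ℂ)}

instance cliffordScalars_normal (n : ℕ) : (CliffordScalars n).Normal := by
  have hle : CliffordScalars n ≤ Subgroup.center (CliffordGroup n) := by
    rw [CliffordScalars, Subgroup.closure_le]
    intro x hx
    rw [SetLike.mem_coe, Subgroup.mem_center_iff]
    intro g
    apply Subtype.ext
    apply Units.ext
    show ((g : GL (Fin (2 ^ n)) ℂ) : Matrix (Fin (2 ^ n)) (Fin (2 ^ n)) ℂ) *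
        ((x : GL (Fin (2 ^ n)) ℂ) : Matrix (Fin (2 ^ n)) (Fin (2 ^ n)) ℂ)
      = ((x : GL (Fin (2 ^ n)) ℂ) : Matrix (Fin (2 ^ n)) (Fin (2 ^ n)) ℂ) *
        ((g : GL (Fin (2 ^ n)) ℂ) : Matrix (Fin (2 ^ n)) (Fin (2 ^ n)) ℂ)
    rw [hx, Matrix.mul_smul, Matrix.smul_mul, mul_one, one_mul]
  constructor
  intro x hx g
  have hc := hle hx
  rw [Subgroup.mem_center_iff] at hc
  rw [hc g]
  simpa using hx

/-- The group of automorphisms of Pauli(n) that fix all scalars, as a subgroup of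
the automorphism group of the Pauli group. -/
def FixAut (n : ℕ) : Subgroup (MulAut (PauliGroup n)) where
  carrier := {φ | ∀ lam ∈ ({1, -1, Complex.I, -Complex.I} : Set ℂ),
    ∀ u : PauliGroup n,
      ((u : GL (Fin (2 ^ n)) ℂ) : Matrix (Fin (2 ^ n)) (Fin (2 ^ n)) ℂ)
        = lam • (1 : Matrix (Fin (2 ^ n)) (Fin (2 ^ n)) ℂ) → φ u = u}
  one_mem' := by intro lam _ u _; rfl
  mul_mem' := by
    intro φ ψ hφ hψ lam hlam u hu
    have h1 := hψ lam hlam u hu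
    have h2 := hφ lam hlam u hu
    show φ (ψ u) = u
    rw [h1, h2]
  inv_mem' := by
    intro φ hφ lam hlam u hu
    have h := hφ lam hlam u hu
    calc φ⁻¹ u = φ⁻¹ (φ u) := by rw [h]
    _ = u := by simp

/-! ### Pauli operators indexed by vectors over `ZMod 2` -/

/-- The Pauli matrix with symplectic coordinates `s`: `X = (1, 0)`, `Z = (0, 1)`, `Y = (1, 1)`. -/
def pauliMatrix (s : ZMod 2 × ZMod 2) : Matrix (Fin 2) (Fin 2) ℂ :=
  if s.1 = 0 then if s.2 = 0 then 1 else PZ else if s.2 = 0 then PX else PY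

/-- The standard symplectic form on `ZMod 2 × ZMod 2`. -/
def qubitForm (s t : ZMod 2 × ZMod 2) : ZMod 2 := s.1 * t.2 + s.2 * t.1

/-- The standard symplectic form on `n` qubits. -/
def qubitsForm {n : ℕ} (u v : Fin n → ZMod 2 × ZMod 2) : ZMod 2 := ∑ i, qubitForm (u i) (v i)

lemma zmod_two_eq (a : ZMod 2) : a = 0 ∨ a = 1 := by
  decide +revert

/-- The nontrivial character `ZMod 2 → {1, -1}`. -/
def parity (a : ZMod 2) : ℂ := if a = 0 then 1 else -1

@[simp] lemma parity_zero : parity 0 = 1 := by simp [parity]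

@[simp] lemma parity_one : parity 1 = -1 := by simp [parity]

lemma parity_add (a b : ZMod 2) : parity (a + b) = parity a * parity b := by
  rcases zmod_two_eq a with rfl | rfl <;> rcases zmod_two_eq b with rfl | rfl <;>
    simp [parity, show (1 + 1 : ZMod 2) = 0 from rfl]

lemma parity_sum {n : ℕ} (f : Fin n → ZMod 2) : parity (∑ i, f i) = ∏ i, parity (f i) := by
  induction n with
  | zero => simp
  | succ n ih => rw [Fin.sum_univ_succ, Fin.prod_univ_succ, parity_add, ih]

lemma pauliMatrix_zero : pauliMatrix 0 = 1 := by simp [pauliMatrix]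

lemma pauliMatrix_mul_self (s : ZMod 2 × ZMod 2) : pauliMatrix s * pauliMatrix s = 1 := by
  obtain ⟨a, b⟩ := s
  rcases zmod_two_eq a with rfl | rfl <;> rcases zmod_two_eq b with rfl | rfl <;>
    simp [pauliMatrix, PX, PY, PZ, Matrix.one_fin_two]

lemma pauliMatrix_comm (s t : ZMod 2 × ZMod 2) :
    pauliMatrix s * pauliMatrix t = parity (qubitForm s t) • (pauliMatrix t * pauliMatrix s) := by
  obtain ⟨a, b⟩ := s
  obtain ⟨c, d⟩ := t
  rcases zmod_two_eq a with rfl | rfl <;> rcases zmod_two_eq b with rfl | rfl <;>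
    rcases zmod_two_eq c with rfl | rfl <;> rcases zmod_two_eq d with rfl | rfl <;>
    simp [pauliMatrix, PX, PY, PZ, qubitForm, show (1 + 1 : ZMod 2) = 0 from rfl]

lemma exists_pauliMatrix_mul (s t : ZMod 2 × ZMod 2) :
    ∃ c : ℂ, c ^ 4 = 1 ∧ pauliMatrix s * pauliMatrix t = c • pauliMatrix (s + t) := by
  have key : ∃ c ∈ ({1, -1, Complex.I, -Complex.I} : Set ℂ),
      pauliMatrix s * pauliMatrix t = c • pauliMatrix (s + t) := by
    obtain ⟨a, b⟩ := s
    obtain ⟨c, d⟩ := t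
    simp only [Set.mem_insert_iff, Set.mem_singleton_iff, exists_eq_or_imp, exists_eq_left]
    rcases zmod_two_eq a with rfl | rfl <;> rcases zmod_two_eq b with rfl | rfl <;>
    rcases zmod_two_eq c with rfl | rfl <;> rcases zmod_two_eq d with rfl | rfl <;>
      simp [pauliMatrix, PX, PY, PZ, Matrix.one_fin_two, show (1 + 1 : ZMod 2) = 0 from rfl,
        Complex.ext_iff]
  obtain ⟨c, hc, h⟩ := key
  refine ⟨c, ?_, h⟩
  rcases hc with rfl | rfl | rfl | rfl <;> norm_num [Even.neg_pow]

lemma pow_four_eq_one_iff (c : ℂ) :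
    c ^ 4 = 1 ↔ c ∈ ({1, -1, Complex.I, -Complex.I} : Set ℂ) := by
  constructor
  · intro h
    have : (c - 1) * ((c + 1) * ((c - Complex.I) * (c + Complex.I))) = 0 := by
      linear_combination h - (c ^ 2 - 1) * Complex.I_sq
    simpa [sub_eq_zero, add_eq_zero_iff_eq_neg] using this
  · rintro (rfl | rfl | rfl | rfl) <;> norm_num [Even.neg_pow]

lemma kron'_mul {m k : ℕ} (A A' : Matrix (Fin m) (Fin m) ℂ) (B B' : Matrix (Fin k) (Fin k) ℂ) :
    kron' (A * A') (B * B') = kron' A B * kron' A' B' := by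
  simp [kron', Matrix.mul_kronecker_mul, Matrix.submatrix_mul_equiv]

lemma kron'_smul_smul {m k : ℕ} (c d : ℂ) (A : Matrix (Fin m) (Fin m) ℂ)
    (B : Matrix (Fin k) (Fin k) ℂ) : kron' (c • A) (d • B) = (c * d) • kron' A B := by
  ext
  simp [kron']
  ring

lemma kron'_one (m k : ℕ) :
    kron' (1 : Matrix (Fin m) (Fin m) ℂ) (1 : Matrix (Fin k) (Fin k) ℂ) = 1 := by
  simp [kron']

lemma tensorPow_mul (n : ℕ) (P Q : Fin n → Matrix (Fin 2) (Fin 2) ℂ) :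
    tensorPow n P * tensorPow n Q = tensorPow n fun i => P i * Q i := by
  induction n with
  | zero => simp [tensorPow]
  | succ n ih =>
    simp only [tensorPow, ← ih, kron'_mul, Matrix.reindex_apply, Matrix.submatrix_mul_equiv]

lemma tensorPow_smul (n : ℕ) (c : Fin n → ℂ) (P : Fin n → Matrix (Fin 2) (Fin 2) ℂ) :
    tensorPow n (fun i => c i • P i) = (∏ i, c i) • tensorPow n P := by
  induction n with
  | zero => simp [tensorPow]
  | succ n ih =>
    simp only [tensorPow, ih, Fin.prod_univ_succ, kron'_smul_smul]
    rfl

lemma tensorPow_one (n : ℕ) : tensorPow n (fun _ => 1) = 1 := by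
  induction n with
  | zero => simp [tensorPow]
  | succ n ih => simp [tensorPow, ih, kron'_one]

lemma tensorPow_apply_mem (F : Subfield ℂ) (n : ℕ) (P : Fin n → Matrix (Fin 2) (Fin 2) ℂ)
    (h : ∀ t i j, P t i j ∈ F) (i j : Fin (2 ^ n)) : tensorPow n P i j ∈ F := by
  induction n with
  | zero =>
    simp only [tensorPow, Matrix.one_apply]
    split_ifs
    exacts [F.one_mem, F.zero_mem]
  | succ n ih => exact F.mul_mem (h _ _ _) (ih _ (fun t => h t.succ) _ _)

/-- The Pauli operator with symplectic coordinates `v`. -/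
def pauliOp {n : ℕ} (v : Fin n → ZMod 2 × ZMod 2) : Matrix (Fin (2 ^ n)) (Fin (2 ^ n)) ℂ :=
  tensorPow n fun i => pauliMatrix (v i)

variable {n : ℕ}

lemma pauliOp_zero : pauliOp (0 : Fin n → ZMod 2 × ZMod 2) = 1 := by
  simp [pauliOp, pauliMatrix_zero, tensorPow_one]

lemma pauliOp_mul_self (v : Fin n → ZMod 2 × ZMod 2) : pauliOp v * pauliOp v = 1 := by
  simp [pauliOp, tensorPow_mul, pauliMatrix_mul_self, tensorPow_one]

lemma pauliOp_comm (u v : Fin n → ZMod 2 × ZMod 2) :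
    pauliOp u * pauliOp v = parity (qubitsForm u v) • (pauliOp v * pauliOp u) := by
  simp_rw [pauliOp, tensorPow_mul, qubitsForm, parity_sum, ← tensorPow_smul, ← pauliMatrix_comm]

lemma exists_pauliOp_mul (u v : Fin n → ZMod 2 × ZMod 2) :
    ∃ c : ℂ, c ^ 4 = 1 ∧ pauliOp u * pauliOp v = c • pauliOp (u + v) := by
  choose c hc h using exists_pauliMatrix_mul
  refine ⟨∏ i, c (u i) (v i), by simp [← Finset.prod_pow, hc], ?_⟩
  simp_rw [pauliOp, tensorPow_mul, h, tensorPow_smul, Pi.add_apply]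

lemma pauliOp_ne_zero (v : Fin n → ZMod 2 × ZMod 2) : pauliOp v ≠ 0 := by
  intro h
  simpa [h] using pauliOp_mul_self v

/-- `M` is an element of the Pauli group. -/
def IsPauli (M : Matrix (Fin (2 ^ n)) (Fin (2 ^ n)) ℂ) : Prop :=
  ∃ (c : ℂ) (v : Fin n → ZMod 2 × ZMod 2), c ^ 4 = 1 ∧ M = c • pauliOp v

lemma mem_pauliSet_iff (M : Matrix (Fin (2 ^ n)) (Fin (2 ^ n)) ℂ) :
    M ∈ PauliSet n ↔ IsPauli M := by
  have hrange : ∀ P : Matrix (Fin 2) (Fin 2) ℂ,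
      P ∈ ({1, PX, PY, PZ} : Set (Matrix (Fin 2) (Fin 2) ℂ)) ↔ ∃ s, pauliMatrix s = P := by
    intro P
    constructor
    · rintro (rfl | rfl | rfl | rfl)
      exacts [⟨(0, 0), rfl⟩, ⟨(1, 0), rfl⟩, ⟨(1, 1), rfl⟩, ⟨(0, 1), rfl⟩]
    · rintro ⟨⟨a, b⟩, rfl⟩
      rcases zmod_two_eq a with rfl | rfl <;> rcases zmod_two_eq b with rfl | rfl <;>
        simp [pauliMatrix]
  constructor
  · rintro ⟨c, P, hc, hP, rfl⟩
    choose v hv using fun i => (hrange (P i)).1 (hP i)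
    exact ⟨c, v, (pow_four_eq_one_iff c).2 hc, by simp [pauliOp, hv]⟩
  · rintro ⟨c, v, hc, rfl⟩
    exact ⟨c, _, (pow_four_eq_one_iff c).1 hc, fun i => (hrange _).2 ⟨v i, rfl⟩, rfl⟩

lemma isPauli_pauliOp (v : Fin n → ZMod 2 × ZMod 2) : IsPauli (pauliOp v) :=
  ⟨1, v, by simp, by simp⟩

lemma IsPauli.smul {M : Matrix (Fin (2 ^ n)) (Fin (2 ^ n)) ℂ} (h : IsPauli M) {c : ℂ}
    (hc : c ^ 4 = 1) : IsPauli (c • M) := by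
  obtain ⟨d, v, hd, rfl⟩ := h
  exact ⟨c * d, v, by rw [mul_pow, hc, hd, one_mul], smul_smul _ _ _⟩

lemma IsPauli.mul {M N : Matrix (Fin (2 ^ n)) (Fin (2 ^ n)) ℂ} (hM : IsPauli M)
    (hN : IsPauli N) : IsPauli (M * N) := by
  obtain ⟨c, u, hc, rfl⟩ := hM
  obtain ⟨d, v, hd, rfl⟩ := hN
  obtain ⟨e, he, h⟩ := exists_pauliOp_mul u v
  refine ⟨c * d * e, u + v, by rw [mul_pow, mul_pow, hc, hd, he]; norm_num, ?_⟩
  rw [smul_mul_smul_comm, h, smul_smul]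

lemma IsPauli.comm_or_anticomm {M N : Matrix (Fin (2 ^ n)) (Fin (2 ^ n)) ℂ} (hM : IsPauli M)
    (hN : IsPauli N) : M * N = N * M ∨ M * N = -(N * M) := by
  obtain ⟨c, u, hc, rfl⟩ := hM
  obtain ⟨d, v, hd, rfl⟩ := hN
  rw [smul_mul_smul_comm, smul_mul_smul_comm, pauliOp_comm u v, mul_comm d c]
  by_cases h : qubitsForm u v = 0 <;> simp [h, parity]

lemma eq_one_or_eq_neg_one_of_smul_pauliOp {c : ℂ} {v : Fin n → ZMod 2 × ZMod 2}
    (h : (c • pauliOp v) * (c • pauliOp v) = 1) : c = 1 ∨ c = -1 := by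
  rw [smul_mul_smul_comm, pauliOp_mul_self] at h
  refine mul_self_eq_one_iff.1 ?_
  simpa using congrFun (congrFun h ⟨0, by positivity⟩) ⟨0, by positivity⟩

lemma IsPauli.eq_or_eq_neg {M : Matrix (Fin (2 ^ n)) (Fin (2 ^ n)) ℂ} (hM : IsPauli M)
    (h : M * M = 1) : ∃ v, M = pauliOp v ∨ M = -pauliOp v := by
  obtain ⟨c, v, hc, rfl⟩ := hM
  refine ⟨v, ?_⟩
  rcases eq_one_or_eq_neg_one_of_smul_pauliOp h with rfl | rfl <;> simp

lemma mem_pauliGroup_iff (u : GL (Fin (2 ^ n)) ℂ) :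
    u ∈ PauliGroup n ↔ IsPauli (u : Matrix (Fin (2 ^ n)) (Fin (2 ^ n)) ℂ) := by
  constructor
  · intro h
    induction h using Subgroup.closure_induction with
    | mem x hx => exact (mem_pauliSet_iff _).1 hx
    | one => exact ⟨1, 0, by simp, by simp [pauliOp_zero]⟩
    | mul x y _ _ hx hy => exact hx.mul hy
    | inv x _ hx =>
      obtain ⟨c, v, hc, h⟩ := hx
      refine ⟨c ^ 3, v, by rw [← pow_mul, mul_comm, pow_mul, hc, one_pow], ?_⟩
      rw [← Units.mul_eq_one_iff_inv_eq, h, smul_mul_smul_comm, pauliOp_mul_self, ← pow_succ',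
        hc, one_smul]
  · intro h
    exact Subgroup.subset_closure ((mem_pauliSet_iff _).2 h)

/-! ### Gates as tensor products -/

lemma kron'_apply {m k : ℕ} (A : Matrix (Fin m) (Fin m) ℂ) (B : Matrix (Fin k) (Fin k) ℂ)
    (i j : Fin (m * k)) :
    kron' A B i j = A i.divNat j.divNat * B i.modNat j.modNat := rfl

lemma embed_apply (a c b n : ℕ) (h : a + c + b = n)
    (G : Matrix (Fin (2 ^ c)) (Fin (2 ^ c)) ℂ) (i j : Fin (2 ^ n)) :
    embed a c b n h G i j =
      if (i : ℕ) / 2 ^ (c + b) = j / 2 ^ (c + b) ∧ (i : ℕ) % 2 ^ b = j % 2 ^ b then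
        G ⟨i / 2 ^ b % 2 ^ c, Nat.mod_lt _ (by positivity)⟩
          ⟨j / 2 ^ b % 2 ^ c, Nat.mod_lt _ (by positivity)⟩ else 0 := by
  simp only [embed, Matrix.reindex_apply, Matrix.submatrix_apply, kron'_apply, Matrix.one_apply,
    Fin.ext_iff, Fin.coe_divNat, Fin.coe_modNat, finCongr_symm, finCongr_apply, Fin.val_cast,
    pow_add]
  have key : ∀ x : ℕ, x % (2 ^ c * 2 ^ b) % 2 ^ b = x % 2 ^ b := fun x =>
    Nat.mod_mod_of_dvd _ (Dvd.intro_left _ rfl)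
  have key' : ∀ x : ℕ, x % (2 ^ c * 2 ^ b) / 2 ^ b = x / 2 ^ b % 2 ^ c := fun x => by
    rw [mul_comm, Nat.mod_mul_right_div_self]
  rw [key, key, ite_and]
  split_ifs with h1 h2 <;> simp
  congr 1 <;> simp [Fin.ext_iff, key']

lemma tensorPow_succ_apply (n : ℕ) (P : Fin (n + 1) → Matrix (Fin 2) (Fin 2) ℂ)
    (i j : Fin (2 ^ (n + 1))) :
    tensorPow (n + 1) P i j =
      P 0 ⟨i / 2 ^ n, Nat.div_lt_of_lt_mul (by rw [← pow_succ]; exact i.2)⟩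
          ⟨j / 2 ^ n, Nat.div_lt_of_lt_mul (by rw [← pow_succ]; exact j.2)⟩ *
        tensorPow n (fun t => P t.succ) ⟨i % 2 ^ n, Nat.mod_lt _ (by positivity)⟩
          ⟨j % 2 ^ n, Nat.mod_lt _ (by positivity)⟩ := rfl

lemma embed_eq_tensorPow_cons (a c b n : ℕ) (h : a + c + b = n) (h' : a + 1 + c + b = n + 1)
    (G : Matrix (Fin (2 ^ c)) (Fin (2 ^ c)) ℂ) (P : Fin n → Matrix (Fin 2) (Fin 2) ℂ)
    (hP : embed a c b n h G = tensorPow n P) :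
    embed (a + 1) c b (n + 1) h' G =
      tensorPow (n + 1) (Fin.cons 1 P : Fin (n + 1) → Matrix (Fin 2) (Fin 2) ℂ) := by
  ext i j
  rw [tensorPow_succ_apply]
  simp only [Fin.cons_zero, Fin.cons_succ, ← hP, embed_apply, Matrix.one_apply, Fin.mk.injEq]
  have hn : 2 ^ n = 2 ^ (c + b) * 2 ^ a := by rw [← h, ← pow_add]; congr 1; omega
  have hn' : 2 ^ n = 2 ^ b * 2 ^ (c + a) := by rw [← h, ← pow_add]; congr 1; omega
  have h1 : ∀ x : ℕ, x % 2 ^ n % 2 ^ b = x % 2 ^ b := fun x =>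
    Nat.mod_mod_of_dvd _ (hn' ▸ Dvd.intro _ rfl)
  have h2 : ∀ x : ℕ, x % 2 ^ n / 2 ^ b % 2 ^ c = x / 2 ^ b % 2 ^ c := fun x => by
    rw [hn', Nat.mod_mul_right_div_self, pow_add, Nat.mod_mul_right_mod]
  have h3 : ∀ x y : ℕ, x / 2 ^ (c + b) = y / 2 ^ (c + b) ↔
      x / 2 ^ n = y / 2 ^ n ∧ x % 2 ^ n / 2 ^ (c + b) = y % 2 ^ n / 2 ^ (c + b) := fun x y => by
    rw [hn, Nat.mod_mul_right_div_self, Nat.mod_mul_right_div_self, ← Nat.div_div_eq_div_mul,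
      ← Nat.div_div_eq_div_mul]
    constructor
    · intro e
      rw [e]
      exact ⟨rfl, rfl⟩
    · rintro ⟨e1, e2⟩
      rw [← Nat.div_add_mod (x / 2 ^ (c + b)) (2 ^ a), e1, e2, Nat.div_add_mod]
  simp only [h1, h2, h3 i j, and_assoc, ite_and, ite_mul, one_mul, zero_mul]

lemma embed_zero_one (b n : ℕ) (h : 0 + 1 + b = n + 1) (A : Matrix (Fin 2) (Fin 2) ℂ) :
    embed 0 1 b (n + 1) h A =
      tensorPow (n + 1) (Fin.cons A fun _ => 1 : Fin (n + 1) → Matrix (Fin 2) (Fin 2) ℂ) := by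
  obtain rfl : b = n := by omega
  ext i j
  rw [tensorPow_succ_apply]
  have hlt : ∀ x : Fin (2 ^ (b + 1)), (x : ℕ) / 2 ^ (1 + b) = 0 := fun x =>
    Nat.div_eq_of_lt (x.2.trans_eq (by rw [add_comm]))
  have hlt' : ∀ x : Fin (2 ^ (b + 1)), (x : ℕ) / 2 ^ b < 2 := fun x =>
    Nat.div_lt_of_lt_mul (by rw [← pow_succ]; exact x.2)
  simp only [Fin.cons_zero, Fin.cons_succ, tensorPow_one, embed_apply, hlt, true_and,
    Matrix.one_apply, Fin.mk.injEq, mul_ite, mul_one, mul_zero, pow_one,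
    Nat.mod_eq_of_lt (hlt' _)]

lemma embed_zero_two (b n : ℕ) (h : 0 + 2 + b = n + 2) (A B : Matrix (Fin 2) (Fin 2) ℂ) :
    embed 0 2 b (n + 2) h (kron' A B) =
      tensorPow (n + 2)
        (Fin.cons A (Fin.cons B fun _ => 1 : Fin (n + 1) → Matrix (Fin 2) (Fin 2) ℂ) :
          Fin (n + 2) → Matrix (Fin 2) (Fin 2) ℂ) := by
  obtain rfl : b = n := by omega
  ext i j
  rw [tensorPow_succ_apply, tensorPow_succ_apply]
  have hlt : ∀ x : Fin (2 ^ (b + 2)), (x : ℕ) / 2 ^ (2 + b) = 0 := fun x =>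
    Nat.div_eq_of_lt (x.2.trans_eq (by rw [add_comm]))
  have hlt' : ∀ x : Fin (2 ^ (b + 2)), (x : ℕ) / 2 ^ b % 2 ^ 2 = x / 2 ^ b := fun x =>
    Nat.mod_eq_of_lt (Nat.div_lt_of_lt_mul (by rw [← pow_add]; exact x.2))
  have h1 : ∀ x : ℕ, x % 2 ^ (b + 1) % 2 ^ b = x % 2 ^ b := fun x =>
    Nat.mod_mod_of_dvd _ (pow_dvd_pow _ (by omega))
  have h2 : ∀ x : ℕ, x % 2 ^ (b + 1) / 2 ^ b = x / 2 ^ b % 2 := fun x => by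
    rw [pow_succ, Nat.mod_mul_right_div_self]
  have h3 : ∀ x : ℕ, x / 2 ^ (b + 1) = x / 2 ^ b / 2 := fun x => by
    rw [pow_succ, Nat.div_div_eq_div_mul]
  simp only [Fin.cons_zero, Fin.cons_succ, tensorPow_one, embed_apply, hlt, true_and, hlt',
    Matrix.one_apply, Fin.mk.injEq, mul_ite, mul_one, mul_zero, h1, h2, h3]
  rfl

/-- The coordinates of the Pauli operator acting as `s` on qubit `a`. -/
def atQubit (n a : ℕ) (s : ZMod 2 × ZMod 2) : Fin n → ZMod 2 × ZMod 2 :=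
  fun i => if i.val = a then s else 0

lemma embed_one_eq_tensorPow (a b n : ℕ) (h : a + 1 + b = n) (A : Matrix (Fin 2) (Fin 2) ℂ) :
    embed a 1 b n h A = tensorPow n fun i => if i.val = a then A else 1 := by
  induction a generalizing n with
  | zero =>
    obtain ⟨m, rfl⟩ : ∃ m, n = m + 1 := ⟨b, by omega⟩
    rw [embed_zero_one]
    congr 1
    funext i
    refine Fin.cases ?_ (fun i => ?_) i <;> simp
  | succ a ih =>
    obtain ⟨m, rfl⟩ : ∃ m, n = m + 1 := ⟨a + 1 + b, by omega⟩
    rw [embed_eq_tensorPow_cons a 1 b m (by omega) h A _ (ih m (by omega))]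
    congr 1
    funext i
    refine Fin.cases ?_ (fun i => ?_) i <;> simp

lemma embed_two_eq_tensorPow (a b n : ℕ) (h : a + 2 + b = n) (A B : Matrix (Fin 2) (Fin 2) ℂ) :
    embed a 2 b n h (kron' A B) =
      tensorPow n fun i => if i.val = a then A else if i.val = a + 1 then B else 1 := by
  induction a generalizing n with
  | zero =>
    obtain ⟨m, rfl⟩ : ∃ m, n = m + 2 := ⟨b, by omega⟩
    rw [embed_zero_two]
    congr 1
    funext i
    refine Fin.cases ?_ (fun i => ?_) i
    · simp
    · refine Fin.cases ?_ (fun i => ?_) i <;> simp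
  | succ a ih =>
    obtain ⟨m, rfl⟩ : ∃ m, n = m + 1 := ⟨a + 2 + b, by omega⟩
    rw [embed_eq_tensorPow_cons a 2 b m (by omega) h _ _ (ih m (by omega))]
    congr 1
    funext i
    refine Fin.cases ?_ (fun i => ?_) i <;> simp

lemma pauliOp_Z (a b n : ℕ) (h : a + 1 + b = n) :
    pauliOp (atQubit n a (0, 1)) = embed a 1 b n h PZ := by
  rw [embed_one_eq_tensorPow, pauliOp]
  congr 1
  funext i
  by_cases hi : i.val = a <;> simp [hi, atQubit, pauliMatrix]

lemma pauliOp_X (a b n : ℕ) (h : a + 1 + b = n) :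
    pauliOp (atQubit n a (1, 0)) = embed a 1 b n h PX := by
  rw [embed_one_eq_tensorPow, pauliOp]
  congr 1
  funext i
  by_cases hi : i.val = a <;> simp [hi, atQubit, pauliMatrix]

lemma pauliOp_ZI (a b n : ℕ) (h : a + 2 + b = n) :
    pauliOp (atQubit n a (0, 1)) = embed a 2 b n h (kron' PZ 1) := by
  rw [embed_two_eq_tensorPow, pauliOp]
  congr 1
  funext i
  by_cases hi : i.val = a <;> simp [hi, atQubit, pauliMatrix]

lemma pauliOp_IZ (a b n : ℕ) (h : a + 2 + b = n) :
    pauliOp (atQubit n (a + 1) (0, 1)) = embed a 2 b n h (kron' 1 PZ) := by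
  rw [embed_two_eq_tensorPow, pauliOp]
  congr 1
  funext i
  by_cases hi : i.val = a <;> by_cases hi' : i.val = a + 1 <;> simp [hi, hi', atQubit, pauliMatrix]

lemma pauliOp_ZZ (a b n : ℕ) (h : a + 2 + b = n) :
    pauliOp (atQubit n a (0, 1) + atQubit n (a + 1) (0, 1)) = embed a 2 b n h (kron' PZ PZ) := by
  rw [embed_two_eq_tensorPow, pauliOp]
  congr 1
  funext i
  by_cases hi : i.val = a <;> by_cases hi' : i.val = a + 1 <;> simp [hi, hi', atQubit, pauliMatrix]

lemma embed_mul (a c b n : ℕ) (h : a + c + b = n) (A B : Matrix (Fin (2 ^ c)) (Fin (2 ^ c)) ℂ) :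
    embed a c b n h (A * B) = embed a c b n h A * embed a c b n h B := by
  simp only [embed, Matrix.reindex_apply, Matrix.submatrix_mul_equiv, ← kron'_mul, mul_one]

lemma embed_smul (a c b n : ℕ) (h : a + c + b = n) (r : ℂ)
    (A : Matrix (Fin (2 ^ c)) (Fin (2 ^ c)) ℂ) :
    embed a c b n h (r • A) = r • embed a c b n h A := by
  ext i j
  simp [embed_apply]

lemma embed_add (a c b n : ℕ) (h : a + c + b = n) (A B : Matrix (Fin (2 ^ c)) (Fin (2 ^ c)) ℂ) :
    embed a c b n h (A + B) = embed a c b n h A + embed a c b n h B := by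
  ext i j
  simp only [embed_apply, Matrix.add_apply]
  split_ifs <;> simp

lemma embed_one (a c b n : ℕ) (h : a + c + b = n) : embed a c b n h 1 = 1 := by
  simp [embed, kron'_one]

/-! ### Rotations about Pauli operators generate the Clifford group -/

/-- The rotation `exp (iπP/4) = (1 + iP)/√2` about an involution `P`. -/
def pauliRot {m : ℕ} (P : Matrix (Fin m) (Fin m) ℂ) : Matrix (Fin m) (Fin m) ℂ :=
  (Real.sqrt 2 : ℂ)⁻¹ • (1 + Complex.I • P)

lemma sqrt_two_sq : (Real.sqrt 2 : ℂ) ^ 2 = 2 := by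
  exact_mod_cast Real.sq_sqrt (by norm_num : (0 : ℝ) ≤ 2)

lemma inv_sqrt_two_sq : ((Real.sqrt 2 : ℂ)⁻¹) ^ 2 = 2⁻¹ := by
  rw [inv_pow, sqrt_two_sq]

lemma omega_eq : ω = (Real.sqrt 2 : ℂ)⁻¹ * (1 + Complex.I) := by
  have h2 : (Real.sqrt 2 : ℂ)⁻¹ = Real.sqrt 2 / 2 := by
    have := sqrt_two_sq
    have h0 : (Real.sqrt 2 : ℂ) ≠ 0 := by
      intro h
      simp [h] at this
    field_simp
    exact this.symm
  rw [ω, show Complex.I * Real.pi / 4 = ((Real.pi / 4 : ℝ) : ℂ) * Complex.I by push_cast; ring,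
    Complex.exp_mul_I, ← Complex.ofReal_cos, ← Complex.ofReal_sin, Real.cos_pi_div_four,
    Real.sin_pi_div_four, h2]
  push_cast
  ring

lemma omega_sq : ω ^ 2 = Complex.I := by
  rw [omega_eq, mul_pow, inv_sqrt_two_sq]
  linear_combination (2⁻¹ : ℂ) * Complex.I_sq

lemma isPrimitiveRoot_omega : IsPrimitiveRoot ω 8 := by
  have := Complex.isPrimitiveRoot_exp 8 (by norm_num)
  convert this using 1
  rw [ω]
  congr 1
  push_cast
  ring

lemma pauliRot_mul_pauliRot_neg {m : ℕ} {P : Matrix (Fin m) (Fin m) ℂ} (h : P * P = 1) :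
    pauliRot P * pauliRot (-P) = 1 := by
  rw [pauliRot, pauliRot, smul_mul_smul_comm, ← sq, inv_sqrt_two_sq]
  simp only [add_mul, mul_add, smul_mul_smul_comm, mul_one, one_mul, mul_neg, smul_neg, h,
    Complex.I_mul_I, neg_smul, one_smul]
  rw [show (1 : Matrix (Fin m) (Fin m) ℂ) + Complex.I • P + -(Complex.I • P + -1) = (2 : ℂ) • 1 by
    rw [two_smul]; abel, smul_smul]
  norm_num

lemma pauliRot_one {m : ℕ} : pauliRot (1 : Matrix (Fin m) (Fin m) ℂ) = ω • 1 := by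
  rw [pauliRot, omega_eq, mul_smul, add_smul, one_smul]

lemma pauliRot_mul_of_commute {m : ℕ} {P M : Matrix (Fin m) (Fin m) ℂ} (h : P * M = M * P) :
    pauliRot P * M = M * pauliRot P := by
  simp [pauliRot, add_mul, mul_add, h]

lemma pauliRot_mul_of_anticommute {m : ℕ} {P M : Matrix (Fin m) (Fin m) ℂ} (hP : P * P = 1)
    (h : P * M = -(M * P)) : pauliRot P * M = (Complex.I • (P * M)) * pauliRot P := by
  have h2 : P * M * P = -M := by rw [h, neg_mul, mul_assoc, hP, mul_one]
  simp only [pauliRot, smul_mul_assoc, mul_smul_comm, add_mul, mul_add, one_mul, mul_one, h2,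
    smul_smul, smul_neg, smul_add]
  rw [mul_assoc, Complex.I_mul_I, mul_neg_one, neg_smul, neg_neg, add_comm]

/-- The rotation about the Pauli operator with coordinates `v`, as an invertible matrix. -/
def rotUnit (v : Fin n → ZMod 2 × ZMod 2) : GL (Fin (2 ^ n)) ℂ where
  val := pauliRot (pauliOp v)
  inv := pauliRot (-pauliOp v)
  val_inv := pauliRot_mul_pauliRot_neg (pauliOp_mul_self v)
  inv_val := by
    have := pauliRot_mul_pauliRot_neg (P := -pauliOp v) (by simp [pauliOp_mul_self])
    rwa [neg_neg] at this

lemma val_rotUnit (v : Fin n → ZMod 2 × ZMod 2) :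
    (rotUnit v : Matrix (Fin (2 ^ n)) (Fin (2 ^ n)) ℂ) = pauliRot (pauliOp v) := rfl

lemma val_inv_rotUnit (v : Fin n → ZMod 2 × ZMod 2) :
    ((rotUnit v)⁻¹ : GL (Fin (2 ^ n)) ℂ).val = pauliRot (-pauliOp v) := rfl

lemma val_rotUnit_zero :
    (rotUnit 0 : GL (Fin (2 ^ n)) ℂ).val = ω • 1 := by
  rw [val_rotUnit, pauliOp_zero, pauliRot_one]

lemma embed_pauliRot (a c b n : ℕ) (h : a + c + b = n)
    (P : Matrix (Fin (2 ^ c)) (Fin (2 ^ c)) ℂ) :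
    embed a c b n h (pauliRot P) = pauliRot (embed a c b n h P) := by
  rw [pauliRot, embed_smul, embed_add, embed_smul, embed_one, pauliRot]

lemma pauliRot_PZ_mul_gS : pauliRot PZ * gS = ω • 1 := by
  rw [omega_eq]
  ext i j
  fin_cases i <;> fin_cases j <;> simp [pauliRot, PZ, gS, Matrix.mul_apply]
  · ring
  · linear_combination (-(Real.sqrt 2 : ℂ)⁻¹) * Complex.I_sq

lemma pauliRot_mul_eq_I_smul_gH :
    pauliRot PZ * pauliRot PX * pauliRot PZ = ω ^ 2 • gH := by
  rw [omega_sq]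
  have h : ((Real.sqrt 2 : ℂ)⁻¹) ^ 3 = 2⁻¹ * (Real.sqrt 2 : ℂ)⁻¹ := by
    rw [pow_succ, inv_sqrt_two_sq]
  ext i j
  fin_cases i <;> fin_cases j <;> simp [pauliRot, PZ, PX, gH, Matrix.mul_apply] <;> ring_nf <;>
    simp only [Complex.I_pow_three, Complex.I_sq, h] <;> ring

lemma kron'_PZ_one : kron' PZ (1 : Matrix (Fin 2) (Fin 2) ℂ) =
    Matrix.diagonal (![1, 1, -1, -1] : Fin 4 → ℂ) := by
  ext i j
  fin_cases i <;> fin_cases j <;>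
    simp [kron'_apply, PZ, Fin.divNat, Fin.modNat, Matrix.one_apply, Fin.ext_iff]

lemma kron'_one_PZ : kron' (1 : Matrix (Fin 2) (Fin 2) ℂ) PZ =
    Matrix.diagonal (![1, -1, 1, -1] : Fin 4 → ℂ) := by
  ext i j
  fin_cases i <;> fin_cases j <;> simp [kron'_apply, PZ, Fin.divNat, Fin.modNat]

lemma kron'_PZ_PZ : kron' PZ PZ = Matrix.diagonal (![1, -1, -1, 1] : Fin 4 → ℂ) := by
  ext i j
  fin_cases i <;> fin_cases j <;> simp [kron'_apply, PZ, Fin.divNat, Fin.modNat]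

lemma pauliRot_mul_gCZ :
    pauliRot (kron' PZ (1 : Matrix (Fin 2) (Fin 2) ℂ)) *
      pauliRot (kron' (1 : Matrix (Fin 2) (Fin 2) ℂ) PZ) * gCZ = ω • pauliRot (kron' PZ PZ) := by
  have hd : ∀ d : Fin 4 → ℂ, pauliRot (Matrix.diagonal d) =
      Matrix.diagonal fun i => (Real.sqrt 2 : ℂ)⁻¹ * (1 + Complex.I * d i) := by
    intro d
    rw [pauliRot, ← Matrix.diagonal_one, ← Matrix.diagonal_smul, Matrix.diagonal_add,
      ← Matrix.diagonal_smul]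
    rfl
  have hCZ : gCZ = Matrix.diagonal ![1, 1, 1, -1] := by
    ext i j
    fin_cases i <;> fin_cases j <;> simp [gCZ]
  rw [kron'_PZ_one, kron'_one_PZ, kron'_PZ_PZ, hCZ, omega_eq]
  erw [hd, hd, hd]
  rw [Matrix.diagonal_mul_diagonal, Matrix.diagonal_mul_diagonal]
  erw [← Matrix.diagonal_smul]
  congr 1
  funext i
  fin_cases i <;> simp <;> ring_nf <;> simp only [Complex.I_sq] <;> ring

lemma val_embed_gS (a b n : ℕ) (h : a + 1 + b = n) :
    ((rotUnit (atQubit n a (0, 1)))⁻¹ * rotUnit 0 : GL (Fin (2 ^ n)) ℂ).val =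
      embed a 1 b n h gS := by
  rw [Units.val_mul, Units.inv_mul_eq_iff_eq_mul, val_rotUnit_zero, val_rotUnit,
    pauliOp_Z a b n h, ← embed_pauliRot a 1 b n h, ← embed_mul]
  erw [pauliRot_PZ_mul_gS, embed_smul, embed_one]

lemma val_embed_gH (a b n : ℕ) (h : a + 1 + b = n) :
    ((rotUnit 0 ^ 2)⁻¹ * (rotUnit (atQubit n a (0, 1)) * rotUnit (atQubit n a (1, 0)) *
      rotUnit (atQubit n a (0, 1))) : GL (Fin (2 ^ n)) ℂ).val = embed a 1 b n h gH := by
  rw [Units.val_mul, Units.inv_mul_eq_iff_eq_mul, Units.val_pow_eq_pow_val, val_rotUnit_zero,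
    smul_pow, one_pow, smul_mul_assoc, one_mul, Units.val_mul, Units.val_mul, val_rotUnit,
    val_rotUnit, pauliOp_Z a b n h, pauliOp_X a b n h]
  simp only [← embed_pauliRot, ← embed_mul, ← embed_smul]
  exact congrArg _ pauliRot_mul_eq_I_smul_gH

lemma val_embed_gCZ (a b n : ℕ) (h : a + 2 + b = n) :
    ((rotUnit (atQubit n a (0, 1)) * rotUnit (atQubit n (a + 1) (0, 1)))⁻¹ *
      (rotUnit 0 * rotUnit (atQubit n a (0, 1) + atQubit n (a + 1) (0, 1))) :
        GL (Fin (2 ^ n)) ℂ).val =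
        embed a 2 b n h gCZ := by
  rw [Units.val_mul, Units.inv_mul_eq_iff_eq_mul, Units.val_mul, Units.val_mul, val_rotUnit_zero,
    val_rotUnit, val_rotUnit, val_rotUnit, pauliOp_ZI a b n h, pauliOp_IZ a b n h,
    pauliOp_ZZ a b n h, smul_mul_assoc, one_mul]
  simp only [← embed_pauliRot, ← embed_mul, ← embed_smul]
  exact congrArg _ pauliRot_mul_gCZ.symm

lemma qubitsForm_add_left (u v w : Fin n → ZMod 2 × ZMod 2) :
    qubitsForm (u + v) w = qubitsForm u w + qubitsForm v w := by
  rw [qubitsForm, qubitsForm, qubitsForm, ← Finset.sum_add_distrib]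
  refine Finset.sum_congr rfl fun i _ => ?_
  simp only [qubitForm, Pi.add_apply, Prod.fst_add, Prod.snd_add]
  ring

lemma qubitsForm_symm (u v : Fin n → ZMod 2 × ZMod 2) : qubitsForm u v = qubitsForm v u := by
  refine Finset.sum_congr rfl fun i _ => ?_
  simp only [qubitForm]
  ring

lemma qubitsForm_add_right (u v w : Fin n → ZMod 2 × ZMod 2) :
    qubitsForm u (v + w) = qubitsForm u v + qubitsForm u w := by
  rw [qubitsForm_symm, qubitsForm_add_left, qubitsForm_symm v, qubitsForm_symm w]

lemma qubitsForm_self (u : Fin n → ZMod 2 × ZMod 2) : qubitsForm u u = 0 := by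
  refine Finset.sum_eq_zero fun i _ => ?_
  generalize u i = s
  decide +revert

lemma qubitsForm_atQubit (v : Fin n → ZMod 2 × ZMod 2) {a : ℕ} (ha : a < n)
    (s : ZMod 2 × ZMod 2) : qubitsForm v (atQubit n a s) = qubitForm (v ⟨a, ha⟩) s := by
  rw [qubitsForm, Finset.sum_eq_single ⟨a, ha⟩]
  · simp [atQubit]
  · intro i _ hi
    have : i.val ≠ a := fun h => hi (Fin.ext h)
    simp [atQubit, this, qubitForm]
  · simp

lemma atQubit_add (n a : ℕ) (s t : ZMod 2 × ZMod 2) :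
    atQubit n a s + atQubit n a t = atQubit n a (s + t) := by
  funext i
  by_cases h : i.val = a <;> simp [atQubit, h]

lemma atQubit_apply_self {a : ℕ} (ha : a < n) (s : ZMod 2 × ZMod 2) :
    atQubit n a s ⟨a, ha⟩ = s := by
  simp [atQubit]

lemma atQubit_apply_of_ne {a : ℕ} {i : Fin n} (h : i.val ≠ a) (s : ZMod 2 × ZMod 2) :
    atQubit n a s i = 0 := by
  simp [atQubit, h]

lemma atQubit_zero (n a : ℕ) : atQubit n a 0 = 0 := by
  funext i
  simp [atQubit]

lemma add_add_cancel_of_zmod_two (u v : Fin n → ZMod 2 × ZMod 2) : u + v + v = u := by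
  have : ∀ s t : ZMod 2 × ZMod 2, s + t + t = s := by decide
  funext i
  exact this _ _

lemma exists_qubitForm_eq_one {s : ZMod 2 × ZMod 2} (hs : s ≠ 0) :
    ∃ t, t ≠ 0 ∧ qubitForm s t = 1 := by
  decide +revert

/-- A set of Pauli operators (up to phase) closed under products of anticommuting pairs which
contains the single-qubit operators `X`, `Z` and the neighbouring pairs `Z ⊗ Z` is everything. -/
lemma forall_of_anticommuting_closed {T : (Fin n → ZMod 2 × ZMod 2) → Prop} (h0 : T 0)
    (hX : ∀ a < n, T (atQubit n a (1, 0))) (hZ : ∀ a < n, T (atQubit n a (0, 1)))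
    (hZZ : ∀ a, a + 1 < n → T (atQubit n a (0, 1) + atQubit n (a + 1) (0, 1)))
    (hadd : ∀ u v, T u → T v → qubitsForm u v = 1 → T (u + v))
    (v : Fin n → ZMod 2 × ZMod 2) : T v := by
  have hsingle : ∀ a < n, ∀ s, T (atQubit n a s) := by
    intro a ha s
    have hs : s = 0 ∨ s = (1, 0) ∨ s = (0, 1) ∨ s = (1, 0) + (0, 1) := by decide +revert
    rcases hs with rfl | rfl | rfl | rfl
    · rwa [atQubit_zero]
    · exact hX a ha
    · exact hZ a ha
    · rw [← atQubit_add]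
      refine hadd _ _ (hX a ha) (hZ a ha) ?_
      rw [qubitsForm_atQubit _ ha, atQubit_apply_self]
      decide
  have hchange : ∀ s s' : ZMod 2 × ZMod 2, s ≠ 0 → s' ≠ 0 → s ≠ s' →
      qubitForm s (s + s') = 1 := by decide
  have hcancel : ∀ s s' : ZMod 2 × ZMod 2, s + (s + s') = s' := by decide
  have hleft : ∀ a, a + 1 < n → ∀ s s' t, s ≠ 0 → s' ≠ 0 →
      T (atQubit n a s + atQubit n (a + 1) t) → T (atQubit n a s' + atQubit n (a + 1) t) := by
    intro a ha s s' t hs hs' h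
    by_cases hne : s = s'
    · rwa [← hne]
    have := hadd _ _ h (hsingle a (by omega) (s + s')) (by
      rw [qubitsForm_atQubit _ (by omega), Pi.add_apply, atQubit_apply_self,
        atQubit_apply_of_ne (by simp), add_zero]
      exact hchange s s' hs hs' hne)
    rwa [add_right_comm, atQubit_add, hcancel] at this
  have hright : ∀ a, a + 1 < n → ∀ s t t', t ≠ 0 → t' ≠ 0 →
      T (atQubit n a s + atQubit n (a + 1) t) → T (atQubit n a s + atQubit n (a + 1) t') := by
    intro a ha s t t' ht ht' h
    by_cases hne : t = t'
    · rwa [← hne]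
    have := hadd _ _ h (hsingle (a + 1) ha (t + t')) (by
      rw [qubitsForm_atQubit _ ha, Pi.add_apply, atQubit_apply_self,
        atQubit_apply_of_ne (by simp), zero_add]
      exact hchange t t' ht ht' hne)
    rwa [add_assoc, atQubit_add, hcancel] at this
  have hpair : ∀ a, a + 1 < n → ∀ s t, s ≠ 0 → t ≠ 0 →
      T (atQubit n a s + atQubit n (a + 1) t) := fun a ha s t hs ht =>
    hright a ha s (0, 1) t (by decide) ht
      (hleft a ha (0, 1) s (0, 1) (by decide) hs (hZZ a ha))
  have main : ∀ k ≤ n, ∀ v, (∀ i : Fin n, k ≤ i.val → v i = 0) → T v := by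
    intro k
    induction k with
    | zero =>
      intro _ v hv
      rwa [show v = 0 from funext fun i => hv i (by omega)]
    | succ k ih =>
      intro hk v hv
      rcases k with _ | a
      · have : v = atQubit n 0 (v ⟨0, by omega⟩) := by
          funext i
          by_cases hi : i.val = 0
          · rw [show i = ⟨0, by omega⟩ from Fin.ext hi, atQubit_apply_self]
          · rw [atQubit_apply_of_ne hi, hv i (by omega)]
        rw [this]
        exact hsingle 0 (by omega) _
      have ha : a < n := by omega
      have ha' : a + 1 < n := by omega
      have hform : ∀ (w : Fin n → ZMod 2 × ZMod 2) (s t : ZMod 2 × ZMod 2),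
          qubitsForm w (atQubit n a s + atQubit n (a + 1) t) =
            qubitForm (w ⟨a, ha⟩) s + qubitForm (w ⟨a + 1, ha'⟩) t := fun w s t => by
        rw [qubitsForm_add_right, qubitsForm_atQubit _ ha, qubitsForm_atQubit _ ha']
      have hself : ∀ s : ZMod 2 × ZMod 2, qubitForm s s = 0 := by decide
      have hstep : ∀ w p : Fin n → ZMod 2 × ZMod 2, T (w + p) → T p → qubitsForm w p = 1 →
          T w := fun w p h1 h2 h3 => by
        have := hadd _ _ h1 h2 (by rw [qubitsForm_add_left, qubitsForm_self, h3, add_zero])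
        rwa [add_add_cancel_of_zmod_two] at this
      have hnonzero : ∀ w : Fin n → ZMod 2 × ZMod 2, (∀ i : Fin n, a + 2 ≤ i.val → w i = 0) →
          w ⟨a, ha⟩ ≠ 0 → T w := by
        intro w hw hwa
        by_cases hA : w ⟨a + 1, ha'⟩ = 0
        · refine ih (by omega) w fun i hi => ?_
          rcases hi.eq_or_lt with h | h
          · rwa [show i = ⟨a + 1, ha'⟩ from Fin.ext h.symm]
          · exact hw i h
        obtain ⟨d, hd, hd'⟩ := exists_qubitForm_eq_one hwa
        refine hstep w (atQubit n a d + atQubit n (a + 1) (w ⟨a + 1, ha'⟩))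
          (ih (by omega) _ fun i hi => ?_) (hpair a ha' _ _ hd hA)
          (by rw [hform, hd', hself, add_zero])
        have hne : i.val ≠ a := by omega
        rw [Pi.add_apply, Pi.add_apply, atQubit_apply_of_ne hne, zero_add]
        rcases hi.eq_or_lt with h | h
        · rw [show i = ⟨a + 1, ha'⟩ from Fin.ext h.symm, atQubit_apply_self]
          generalize w ⟨a + 1, ha'⟩ = s
          decide +revert
        · rw [hw i h, atQubit_apply_of_ne (by omega), add_zero]
      by_cases hB : v ⟨a, ha⟩ = 0
      · by_cases hA : v ⟨a + 1, ha'⟩ = 0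
        · refine ih (by omega) v fun i hi => ?_
          rcases hi.eq_or_lt with h | h
          · rwa [show i = ⟨a + 1, ha'⟩ from Fin.ext h.symm]
          · exact hv i h
        obtain ⟨f, hf, hf'⟩ := exists_qubitForm_eq_one hA
        refine hstep v (atQubit n a (1, 0) + atQubit n (a + 1) f) (hnonzero _ (fun i hi => ?_) ?_)
          (hpair a ha' _ _ (by decide) hf) ?_
        · rw [Pi.add_apply, Pi.add_apply, hv i hi, atQubit_apply_of_ne (by omega),
            atQubit_apply_of_ne (by omega)]
          rfl
        · rw [Pi.add_apply, Pi.add_apply, hB, atQubit_apply_self, atQubit_apply_of_ne (by simp)]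
          decide
        · rw [hform, hB, hf']
          decide
      · exact hnonzero v hv hB
  exact main n le_rfl v fun i hi => absurd i.2 (by omega)

lemma I_smul_mul_mul_self {m : ℕ} {P M : Matrix (Fin m) (Fin m) ℂ} (hP : P * P = 1)
    (hM : M * M = 1) (h : P * M = -(M * P)) :
    (Complex.I • (P * M)) * (Complex.I • (P * M)) = 1 := by
  rw [smul_mul_smul_comm, Complex.I_mul_I]
  nth_rw 2 [h]
  rw [mul_neg, neg_smul, one_smul, neg_neg, mul_assoc, ← mul_assoc M, hM, one_mul, hP]

lemma pauliRot_mul_pauliRot_of_anticommute {m : ℕ} {P M : Matrix (Fin m) (Fin m) ℂ}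
    (hP : P * P = 1) (h : P * M = -(M * P)) :
    pauliRot P * pauliRot M = pauliRot (Complex.I • (P * M)) * pauliRot P := by
  rw [pauliRot.eq_def M, pauliRot.eq_def (Complex.I • (P * M)), mul_smul_comm, smul_mul_assoc,
    mul_add, add_mul, mul_smul_comm, pauliRot_mul_of_anticommute hP h, smul_mul_assoc, mul_one,
    one_mul, smul_mul_assoc, smul_mul_assoc]

lemma rotUnit_add_mem {G : Subgroup (GL (Fin (2 ^ n)) ℂ)} {u v : Fin n → ZMod 2 × ZMod 2}
    (hu : rotUnit u ∈ G) (hv : rotUnit v ∈ G) (h : qubitsForm u v = 1) :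
    rotUnit (u + v) ∈ G := by
  have hanti : pauliOp u * pauliOp v = -(pauliOp v * pauliOp u) := by
    rw [pauliOp_comm, h, parity_one, neg_one_smul]
  obtain ⟨c, -, hc⟩ := exists_pauliOp_mul u v
  have hsq := I_smul_mul_mul_self (pauliOp_mul_self u) (pauliOp_mul_self v) hanti
  have hrot := pauliRot_mul_pauliRot_of_anticommute (pauliOp_mul_self u) hanti
  rw [hc, smul_smul] at hsq hrot
  have hconj : rotUnit u * rotUnit v * (rotUnit u)⁻¹ ∈ G :=
    G.mul_mem (G.mul_mem hu hv) (G.inv_mem hu)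
  rcases eq_one_or_eq_neg_one_of_smul_pauliOp hsq with h1 | h1
  · convert hconj
    rw [eq_mul_inv_iff_mul_eq]
    ext1
    rw [Units.val_mul, Units.val_mul, val_rotUnit, val_rotUnit, val_rotUnit, hrot, h1, one_smul]
  · rw [← G.inv_mem_iff]
    convert hconj
    rw [eq_mul_inv_iff_mul_eq]
    ext1
    rw [Units.val_mul, Units.val_mul, val_inv_rotUnit, val_rotUnit, val_rotUnit, hrot, h1,
      neg_one_smul]

lemma mem_cliffordGroup_of_val {u : GL (Fin (2 ^ n)) ℂ}
    (h : (u : Matrix (Fin (2 ^ n)) (Fin (2 ^ n)) ℂ) ∈ CliffordGenSet n) : u ∈ CliffordGroup n :=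
  Subgroup.subset_closure h

lemma rotUnit_mem_cliffordGroup (v : Fin n → ZMod 2 × ZMod 2) :
    rotUnit v ∈ CliffordGroup n := by
  have h0 : rotUnit (0 : Fin n → ZMod 2 × ZMod 2) ∈ CliffordGroup n :=
    mem_cliffordGroup_of_val (Or.inl (Or.inl val_rotUnit_zero))
  have hZ : ∀ a < n, rotUnit (atQubit n a (0, 1)) ∈ CliffordGroup n := by
    intro a ha
    have h : a + 1 + (n - a - 1) = n := by omega
    have := mem_cliffordGroup_of_val (Or.inl (Or.inr ⟨a, _, h, Or.inr (val_embed_gS a _ n h)⟩))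
    rwa [Subgroup.mul_mem_cancel_right _ h0, Subgroup.inv_mem_iff] at this
  refine forall_of_anticommuting_closed (T := fun v => rotUnit v ∈ CliffordGroup n) h0 ?_ hZ ?_
    (fun u v => rotUnit_add_mem) v
  · intro a ha
    have h : a + 1 + (n - a - 1) = n := by omega
    have := mem_cliffordGroup_of_val (Or.inl (Or.inr ⟨a, _, h, Or.inl (val_embed_gH a _ n h)⟩))
    rwa [Subgroup.mul_mem_cancel_left _ (Subgroup.inv_mem _ (Subgroup.pow_mem _ h0 2)),
      Subgroup.mul_mem_cancel_right _ (hZ a ha), Subgroup.mul_mem_cancel_left _ (hZ a ha)] at this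
  · intro a ha
    have h : a + 2 + (n - a - 2) = n := by omega
    have := mem_cliffordGroup_of_val (Or.inr ⟨a, _, h, val_embed_gCZ a _ n h⟩)
    rwa [Subgroup.mul_mem_cancel_left _ (Subgroup.inv_mem _
      (Subgroup.mul_mem _ (hZ a (by omega)) (hZ (a + 1) ha))),
      Subgroup.mul_mem_cancel_left _ h0] at this

theorem cliffordGroup_eq_closure_range_rotUnit (n : ℕ) :
    CliffordGroup n = Subgroup.closure (Set.range rotUnit) := by
  have hr : ∀ v : Fin n → ZMod 2 × ZMod 2, rotUnit v ∈ Subgroup.closure (Set.range rotUnit) :=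
    fun v => Subgroup.subset_closure ⟨v, rfl⟩
  refine le_antisymm ((Subgroup.closure_le _).2 ?_) ((Subgroup.closure_le _).2 ?_)
  · rintro u ((h | ⟨a, b, hn, h | h⟩) | ⟨a, b, hn, h⟩)
    · rw [show u = rotUnit 0 from Units.ext (h.trans val_rotUnit_zero.symm)]
      exact hr _
    · rw [Units.ext (h.trans (val_embed_gH a b n hn).symm)]
      exact Subgroup.mul_mem _ (Subgroup.inv_mem _ (Subgroup.pow_mem _ (hr _) _))
        (Subgroup.mul_mem _ (Subgroup.mul_mem _ (hr _) (hr _)) (hr _))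
    · rw [Units.ext (h.trans (val_embed_gS a b n hn).symm)]
      exact Subgroup.mul_mem _ (Subgroup.inv_mem _ (hr _)) (hr _)
    · rw [Units.ext (h.trans (val_embed_gCZ a b n hn).symm)]
      exact Subgroup.mul_mem _ (Subgroup.inv_mem _ (Subgroup.mul_mem _ (hr _) (hr _)))
        (Subgroup.mul_mem _ (hr _) (hr _))
  · rintro _ ⟨v, rfl⟩
    exact rotUnit_mem_cliffordGroup v

/-! ### The action of the Clifford group on the Pauli group -/

lemma IsPauli.neg {M : Matrix (Fin (2 ^ n)) (Fin (2 ^ n)) ℂ} (h : IsPauli M) : IsPauli (-M) := by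
  simpa using h.smul (c := -1) (by norm_num)

lemma IsPauli.pauliRot_conj {P A : Matrix (Fin (2 ^ n)) (Fin (2 ^ n)) ℂ} (hP : IsPauli P)
    (hPP : P * P = 1) (hA : IsPauli A) : IsPauli (pauliRot P * A * pauliRot (-P)) := by
  rcases hP.comm_or_anticomm hA with h | h
  · rwa [pauliRot_mul_of_commute h, mul_assoc, pauliRot_mul_pauliRot_neg hPP, mul_one]
  · rw [pauliRot_mul_of_anticommute hPP h, mul_assoc, pauliRot_mul_pauliRot_neg hPP, mul_one]
    exact (hP.mul hA).smul Complex.I_pow_four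

lemma cliffordGroup_le_normalizer (n : ℕ) :
    CliffordGroup n ≤ Subgroup.normalizer (PauliGroup n : Set (GL (Fin (2 ^ n)) ℂ)) := by
  rw [cliffordGroup_eq_closure_range_rotUnit, Subgroup.closure_le]
  rintro _ ⟨v, rfl⟩
  refine Subgroup.mem_normalizer_iff.2 fun u => ?_
  have hneg : -pauliOp v * -pauliOp v = (1 : Matrix (Fin (2 ^ n)) (Fin (2 ^ n)) ℂ) := by
    rw [neg_mul_neg, pauliOp_mul_self]
  have hright : ∀ u : GL (Fin (2 ^ n)) ℂ,
      u ∈ PauliGroup n → rotUnit v * u * (rotUnit v)⁻¹ ∈ PauliGroup n := fun u hu => by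
    rw [mem_pauliGroup_iff] at hu ⊢
    exact (isPauli_pauliOp v).pauliRot_conj (pauliOp_mul_self v) hu
  have hleft : ∀ u : GL (Fin (2 ^ n)) ℂ,
      u ∈ PauliGroup n → (rotUnit v)⁻¹ * u * rotUnit v ∈ PauliGroup n := fun u hu => by
    rw [mem_pauliGroup_iff] at hu ⊢
    have := (isPauli_pauliOp v).neg.pauliRot_conj hneg hu
    rwa [neg_neg] at this
  exact ⟨hright u, fun h => by simpa [mul_assoc] using hleft _ h⟩

/-- The automorphism `P ↦ C P C⁻¹` of the Pauli group attached to a Clifford operator `C`. -/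
def cliffordConj (n : ℕ) : CliffordGroup n →* FixAut n :=
  ((PauliGroup n).normalizerMonoidHom.comp
    (Subgroup.inclusion (cliffordGroup_le_normalizer n))).codRestrict (FixAut n) <| by
      intro C lam _ u hu
      have hcomm : C.1 * u.1 = u.1 * C.1 := by
        ext1
        rw [Units.val_mul, Units.val_mul, hu, mul_smul_comm, smul_mul_assoc, mul_one, one_mul]
      exact Subtype.ext (mul_inv_eq_iff_eq_mul.2 hcomm)

lemma coe_cliffordConj_apply (C : CliffordGroup n) (u : PauliGroup n) :
    (((cliffordConj n C : MulAut (PauliGroup n)) u : PauliGroup n) : GL (Fin (2 ^ n)) ℂ) =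
      (C : GL (Fin (2 ^ n)) ℂ) * u * (C : GL (Fin (2 ^ n)) ℂ)⁻¹ := rfl

/-! ### The kernel of the action -/

lemma trace_pauliOp_eq_zero {v : Fin n → ZMod 2 × ZMod 2} (hv : v ≠ 0) :
    (pauliOp v).trace = 0 := by
  obtain ⟨i, hi⟩ := Function.ne_iff.1 hv
  obtain ⟨t, -, ht⟩ := exists_qubitForm_eq_one hi
  have hanti : pauliOp v * pauliOp (atQubit n i t) = -(pauliOp (atQubit n i t) * pauliOp v) := by
    rw [pauliOp_comm, qubitsForm_atQubit _ i.2, ht, parity_one, neg_one_smul]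
  set W := pauliOp (atQubit n i t)
  have hW : W * W = 1 := pauliOp_mul_self _
  have h : (W * pauliOp v * W).trace = (pauliOp v).trace := by
    rw [Matrix.trace_mul_cycle, hW, one_mul]
  rw [mul_assoc, hanti, mul_neg, ← mul_assoc, hW, one_mul, Matrix.trace_neg] at h
  exact self_eq_neg.1 h.symm

lemma linearIndependent_pauliOp (n : ℕ) :
    LinearIndependent ℂ (pauliOp : (Fin n → ZMod 2 × ZMod 2) → _) := by
  rw [Fintype.linearIndependent_iff]
  intro g hg w
  have h := congrArg (fun M => (M * pauliOp w).trace) hg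
  simp only [Finset.sum_mul, smul_mul_assoc, Matrix.trace_sum, Matrix.trace_smul, zero_mul,
    Matrix.trace_zero] at h
  rw [Finset.sum_eq_single w] at h
  · simpa [pauliOp_mul_self] using h
  · intro v _ hv
    obtain ⟨c, -, hc⟩ := exists_pauliOp_mul v w
    have hvw : v + w ≠ 0 := fun h0 => hv <| by
      rw [← add_add_cancel_of_zmod_two v w, h0, zero_add]
    rw [hc, Matrix.trace_smul, trace_pauliOp_eq_zero hvw, smul_zero, smul_zero]
  · simp

lemma span_range_pauliOp (n : ℕ) :
    Submodule.span ℂ (Set.range (pauliOp : (Fin n → ZMod 2 × ZMod 2) → _)) = ⊤ := by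
  refine (linearIndependent_pauliOp n).span_eq_top_of_card_eq_finrank' ?_
  rw [Module.finrank_matrix]
  simp [mul_comm, ← mul_pow]

lemma exists_eq_smul_one_of_commute_pauliOp {M : Matrix (Fin (2 ^ n)) (Fin (2 ^ n)) ℂ}
    (h : ∀ v, M * pauliOp v = pauliOp v * M) : ∃ c : ℂ, M = c • 1 := by
  have hall : ∀ A, M * A = A * M := by
    intro A
    have hA : A ∈ Submodule.span ℂ (Set.range (pauliOp : (Fin n → ZMod 2 × ZMod 2) → _)) := by
      rw [span_range_pauliOp]
      trivial
    induction hA using Submodule.span_induction with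
    | mem A hA =>
      obtain ⟨v, rfl⟩ := hA
      exact h v
    | zero => simp
    | add A B _ _ hA hB => rw [mul_add, add_mul, hA, hB]
    | smul c A _ hA => rw [mul_smul_comm, smul_mul_assoc, hA]
  obtain ⟨c, hc⟩ := Matrix.mem_range_scalar_iff_commute_single'.2
    fun i j => (hall (Matrix.single i j 1)).symm
  exact ⟨c, by rw [← hc, Matrix.scalar_apply, Matrix.smul_one_eq_diagonal]⟩

lemma pauliRot_pow_eight {m : ℕ} {P : Matrix (Fin m) (Fin m) ℂ} (h : P * P = 1) :
    pauliRot P ^ 8 = 1 := by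
  have h2 : pauliRot P ^ 2 = Complex.I • P := by
    rw [pauliRot, smul_pow, inv_sqrt_two_sq, sq]
    simp only [add_mul, mul_add, smul_mul_smul_comm, mul_one, one_mul, h, Complex.I_mul_I]
    rw [show (1 : Matrix (Fin m) (Fin m) ℂ) + Complex.I • P + (Complex.I • P + (-1 : ℂ) • 1) =
      (2 : ℂ) • Complex.I • P by rw [two_smul, neg_one_smul]; abel, smul_smul]
    norm_num
  have hI : (Complex.I • P) ^ 2 = -1 := by
    rw [sq, smul_mul_smul_comm, h, Complex.I_mul_I, neg_one_smul]
  rw [show 8 = 2 * (2 * 2) from rfl, pow_mul, h2, pow_mul, hI]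
  simp

lemma det_pow_eight_of_mem_cliffordGroup {g : GL (Fin (2 ^ n)) ℂ} (hg : g ∈ CliffordGroup n) :
    Matrix.GeneralLinearGroup.det g ^ 8 = 1 := by
  rw [cliffordGroup_eq_closure_range_rotUnit] at hg
  induction hg using Subgroup.closure_induction with
  | mem x hx =>
    obtain ⟨v, rfl⟩ := hx
    rw [← map_pow, show rotUnit v ^ 8 = 1 from Units.ext (pauliRot_pow_eight (pauliOp_mul_self v)),
      map_one]
  | one => simp
  | mul x y _ _ hx hy => rw [map_mul, mul_pow, hx, hy, one_mul]
  | inv x _ hx => rw [map_inv, inv_pow, hx, inv_one]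

open IntermediateField in
lemma pow_eight_eq_one_of_mem_adjoin_omega {c : ℂ} (hc : c ∈ ℚ⟮ω⟯) {k : ℕ} (h : c ^ 2 ^ k = 1) :
    c ^ 8 = 1 := by
  obtain ⟨m, -, hm⟩ := (Nat.dvd_prime_pow Nat.prime_two).1 (orderOf_dvd_of_pow_eq_one h)
  rcases le_or_gt m 3 with h3 | h3
  · rw [← orderOf_dvd_iff_pow_eq_one, hm]
    exact pow_dvd_pow 2 h3
  have hprim : IsPrimitiveRoot (c ^ 2 ^ (m - 4)) 16 := by
    refine IsPrimitiveRoot.pow (hm ▸ by positivity) (IsPrimitiveRoot.orderOf c) ?_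
    rw [hm, show 16 = 2 ^ 4 from rfl, ← pow_add, Nat.sub_add_cancel h3]
  have hω : IsIntegral ℚ ω := (isPrimitiveRoot_omega.isIntegral (by norm_num)).tower_top
  have : FiniteDimensional ℚ ℚ⟮ω⟯ := adjoin.finiteDimensional hω
  have hle := minpoly.natDegree_le (A := ℚ) (⟨_, pow_mem hc (2 ^ (m - 4))⟩ : ℚ⟮ω⟯)
  rw [← minpoly.algebraMap_eq (algebraMap ℚ⟮ω⟯ ℂ).injective] at hle
  erw [← Polynomial.cyclotomic_eq_minpoly_rat hprim (by norm_num)] at hle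
  rw [adjoin.finrank hω, ← Polynomial.cyclotomic_eq_minpoly_rat isPrimitiveRoot_omega
    (by norm_num), Polynomial.natDegree_cyclotomic, Polynomial.natDegree_cyclotomic] at hle
  exact absurd hle (by decide)

lemma apply_mem_of_mem_cliffordGroup {F : Subfield ℂ} (hF : ω ∈ F) {g : GL (Fin (2 ^ n)) ℂ}
    (hg : g ∈ CliffordGroup n) (i j : Fin (2 ^ n)) : g i j ∈ F := by
  have hI : Complex.I ∈ F := omega_sq ▸ F.pow_mem hF 2
  have hinv : (Real.sqrt 2 : ℂ)⁻¹ ∈ F := by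
    have hne : 1 + Complex.I ≠ 0 := fun h => by simpa using congrArg Complex.re h
    rw [eq_div_of_mul_eq hne omega_eq.symm]
    exact F.div_mem hF (F.add_mem F.one_mem hI)
  have hone : ∀ i j, (1 : Matrix (Fin (2 ^ n)) (Fin (2 ^ n)) ℂ) i j ∈ F := fun i j => by
    rw [Matrix.one_apply]
    split_ifs
    exacts [F.one_mem, F.zero_mem]
  have hP : ∀ (v : Fin n → ZMod 2 × ZMod 2) i j, pauliOp v i j ∈ F := fun v i j => by
    refine tensorPow_apply_mem F n _ (fun t i j => ?_) i j
    generalize v t = s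
    obtain ⟨a, b⟩ := s
    rcases zmod_two_eq a with rfl | rfl <;> rcases zmod_two_eq b with rfl | rfl <;>
      fin_cases i <;> fin_cases j <;> simp [pauliMatrix, PX, PY, PZ, hI]
  have hrot : ∀ P : Matrix (Fin (2 ^ n)) (Fin (2 ^ n)) ℂ, (∀ i j, P i j ∈ F) →
      ∀ i j, pauliRot P i j ∈ F := fun P h i j =>
    F.mul_mem hinv (F.add_mem (hone i j) (F.mul_mem hI (h i j)))
  suffices h : (∀ i j, g i j ∈ F) ∧ ∀ i j, g⁻¹.val i j ∈ F from h.1 i j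
  rw [cliffordGroup_eq_closure_range_rotUnit] at hg
  induction hg using Subgroup.closure_induction with
  | mem x hx =>
    obtain ⟨v, rfl⟩ := hx
    exact ⟨hrot _ (hP v), hrot _ fun i j => F.neg_mem (hP v i j)⟩
  | one => exact ⟨hone, by simpa using hone⟩
  | mul x y _ _ hx hy =>
    have hmul : ∀ A B : Matrix (Fin (2 ^ n)) (Fin (2 ^ n)) ℂ, (∀ i j, A i j ∈ F) →
        (∀ i j, B i j ∈ F) → ∀ i j, (A * B) i j ∈ F := fun A B hA hB i j => by
      rw [Matrix.mul_apply]
      exact F.sum_mem fun k _ => F.mul_mem (hA i k) (hB k j)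
    refine ⟨hmul _ _ hx.1 hy.1, ?_⟩
    rw [mul_inv_rev]
    exact hmul _ _ hy.2 hx.2
  | inv x _ hx => exact ⟨hx.2, by rw [inv_inv]; exact hx.1⟩

lemma pow_eight_eq_one_of_smul_one_mem_cliffordGroup {g : GL (Fin (2 ^ n)) ℂ}
    (hg : g ∈ CliffordGroup n) {c : ℂ} (hc : g.val = c • 1) : c ^ 8 = 1 := by
  have hdet := congrArg Units.val (det_pow_eight_of_mem_cliffordGroup hg)
  rw [Units.val_pow_eq_pow_val, Matrix.GeneralLinearGroup.val_det_apply, hc, Matrix.det_smul,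
    Matrix.det_one, mul_one, Fintype.card_fin, ← pow_mul, show 8 = 2 ^ 3 from rfl, ← pow_add,
    Units.val_one] at hdet
  refine pow_eight_eq_one_of_mem_adjoin_omega ?_ hdet
  have := apply_mem_of_mem_cliffordGroup (F := (IntermediateField.adjoin ℚ {ω}).toSubfield)
    (IntermediateField.mem_adjoin_simple_self ℚ ω) hg ⟨0, by positivity⟩ ⟨0, by positivity⟩
  rwa [hc, Matrix.smul_apply, Matrix.one_apply_eq, smul_eq_mul, mul_one] at this

/-- The element `ω • 1` of the Clifford group. -/
def cliffordOmega (n : ℕ) : CliffordGroup n := ⟨rotUnit 0, rotUnit_mem_cliffordGroup 0⟩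

lemma val_cliffordOmega : ((cliffordOmega n : GL (Fin (2 ^ n)) ℂ)).val = ω • 1 := val_rotUnit_zero

theorem ker_cliffordConj (n : ℕ) : (cliffordConj n).ker = CliffordScalars n := by
  refine le_antisymm (fun C hC => ?_) ((Subgroup.closure_le _).2 fun C hC => ?_)
  · have hcomm : ∀ v, C.1.val * pauliOp v = pauliOp v * C.1.val := by
      intro v
      have hv : pauliOp v * pauliOp v = (1 : Matrix (Fin (2 ^ n)) (Fin (2 ^ n)) ℂ) :=
        pauliOp_mul_self v
      let W : GL (Fin (2 ^ n)) ℂ := ⟨pauliOp v, pauliOp v, hv, hv⟩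
      have hW : W ∈ PauliGroup n := (mem_pauliGroup_iff W).2 (isPauli_pauliOp v)
      have h := coe_cliffordConj_apply C ⟨W, hW⟩
      rw [MonoidHom.mem_ker.1 hC] at h
      exact (congrArg Units.val (eq_mul_inv_iff_mul_eq.1 h)).symm
    obtain ⟨c, hc⟩ := exists_eq_smul_one_of_commute_pauliOp hcomm
    obtain ⟨k, -, hk⟩ := isPrimitiveRoot_omega.eq_pow_of_pow_eq_one
      (pow_eight_eq_one_of_smul_one_mem_cliffordGroup C.2 hc)
    have : C = cliffordOmega n ^ k := by
      ext1
      ext1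
      rw [Subgroup.coe_pow, Units.val_pow_eq_pow_val, val_cliffordOmega, smul_pow, one_pow, hk, hc]
    rw [this]
    exact Subgroup.pow_mem _ (Subgroup.subset_closure (by exact val_cliffordOmega)) k
  · refine MonoidHom.mem_ker.2 (Subtype.ext (MulEquiv.ext fun u => Subtype.ext ?_))
    rw [coe_cliffordConj_apply]
    refine mul_inv_eq_iff_eq_mul.2 (Units.ext ?_)
    rw [Units.val_mul, Units.val_mul, hC.out, mul_smul_comm, smul_mul_assoc, mul_one,
      one_mul]
    rfl

/-! ### Scalar-fixing automorphisms are induced by Clifford operators -/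

/-- The Pauli operator with coordinates `v`, as an element of the Pauli group. -/
def pauliElem (v : Fin n → ZMod 2 × ZMod 2) : PauliGroup n :=
  ⟨⟨pauliOp v, pauliOp v, pauliOp_mul_self v, pauliOp_mul_self v⟩,
    (mem_pauliGroup_iff _).2 (isPauli_pauliOp v)⟩

/-- The scalar matrix of a fourth root of unity, as an element of the Pauli group. -/
def pauliScalar {c : ℂ} (hc : c ^ 4 = 1) : PauliGroup n :=
  ⟨⟨c • 1, c ^ 3 • 1, by rw [smul_mul_smul_comm, ← pow_succ', hc, one_smul, mul_one],
      by rw [smul_mul_smul_comm, ← pow_succ, hc, one_smul, mul_one]⟩,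
    (mem_pauliGroup_iff _).2 ⟨c, 0, hc, by rw [pauliOp_zero]⟩⟩

lemma fixAut_apply_eq_smul (φ : FixAut n) {c : ℂ} (hc : c ^ 4 = 1) {x y : PauliGroup n}
    (h : x.1.val = c • y.1.val) : (φ.1 x).1.val = c • (φ.1 y).1.val := by
  have hx : x = pauliScalar hc * y := by
    ext1
    ext1
    rw [h, Subgroup.coe_mul, Units.val_mul]
    exact (smul_one_mul c _).symm
  rw [hx, map_mul, φ.2 c ((pow_four_eq_one_iff c).1 hc) (pauliScalar hc) rfl, Subgroup.coe_mul,
    Units.val_mul]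
  exact smul_one_mul c _

/-- The image of the Pauli operator with coordinates `v` under an automorphism. -/
def autOp (φ : FixAut n) (v : Fin n → ZMod 2 × ZMod 2) : Matrix (Fin (2 ^ n)) (Fin (2 ^ n)) ℂ :=
  (φ.1 (pauliElem v)).1.val

lemma autOp_mul_autOp (φ : FixAut n) (u v : Fin n → ZMod 2 × ZMod 2) :
    autOp φ u * autOp φ v = (φ.1 (pauliElem u * pauliElem v)).1.val := by
  rw [map_mul]
  rfl

lemma autOp_comm (φ : FixAut n) (u v : Fin n → ZMod 2 × ZMod 2) :
    autOp φ u * autOp φ v = parity (qubitsForm u v) • (autOp φ v * autOp φ u) := by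
  rw [autOp_mul_autOp, autOp_mul_autOp]
  refine fixAut_apply_eq_smul φ ?_ (pauliOp_comm u v)
  rcases zmod_two_eq (qubitsForm u v) with h | h <;> rw [h] <;> norm_num

lemma autOp_eq_or_eq_neg (φ : FixAut n) (v : Fin n → ZMod 2 × ZMod 2) :
    ∃ w, autOp φ v = pauliOp w ∨ autOp φ v = -pauliOp w := by
  refine ((mem_pauliGroup_iff _).1 (φ.1 (pauliElem v)).2).eq_or_eq_neg ?_
  have h : pauliElem v * pauliElem v = 1 := Subtype.ext (Units.ext (pauliOp_mul_self v))
  exact (autOp_mul_autOp φ v v).trans (by rw [h, map_one]; rfl)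

lemma parity_injective : Function.Injective parity := by
  intro a b h
  rcases zmod_two_eq a with rfl | rfl <;> rcases zmod_two_eq b with rfl | rfl <;>
    first | rfl | norm_num at h

lemma qubitsForm_eq_of_autOp {φ : FixAut n} {u v u' v' : Fin n → ZMod 2 × ZMod 2}
    (hu : autOp φ u = pauliOp u' ∨ autOp φ u = -pauliOp u')
    (hv : autOp φ v = pauliOp v' ∨ autOp φ v = -pauliOp v') :
    qubitsForm u' v' = qubitsForm u v := by
  have h : pauliOp u' * pauliOp v' = parity (qubitsForm u v) • (pauliOp v' * pauliOp u') := by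
    have := autOp_comm φ u v
    rcases hu with hu | hu <;> rcases hv with hv | hv <;> simpa [hu, hv] using this
  have hne : pauliOp v' * pauliOp u' ≠ 0 := fun h0 => by
    have : pauliOp v' * pauliOp u' * pauliOp u' = 0 := by rw [h0, zero_mul]
    rw [mul_assoc, pauliOp_mul_self, mul_one] at this
    exact pauliOp_ne_zero v' this
  rw [pauliOp_comm] at h
  exact parity_injective (smul_left_injective ℂ hne h)

lemma autOp_add {φ : FixAut n} {u v : Fin n → ZMod 2 × ZMod 2} (hu : autOp φ u = pauliOp u)
    (hv : autOp φ v = pauliOp v) : autOp φ (u + v) = pauliOp (u + v) := by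
  obtain ⟨c, hc, h⟩ := exists_pauliOp_mul u v
  have h' := fixAut_apply_eq_smul φ hc (x := pauliElem u * pauliElem v) (y := pauliElem (u + v)) h
  rw [← autOp_mul_autOp, hu, hv, h] at h'
  have hc0 : c ≠ 0 := fun h0 => by simp [h0] at hc
  exact (smul_right_injective _ hc0 h').symm

lemma eq_one_of_autOp {φ : FixAut n} (h : ∀ v, autOp φ v = pauliOp v) : φ = 1 := by
  refine Subtype.ext (MulEquiv.ext fun x => Subtype.ext (Units.ext ?_))
  obtain ⟨c, v, hc, hx⟩ := (mem_pauliGroup_iff x.1).1 x.2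
  rw [fixAut_apply_eq_smul φ hc (y := pauliElem v) hx]
  exact (congrArg (c • ·) (h v)).trans hx.symm

lemma autOp_cliffordConj_mul {g : GL (Fin (2 ^ n)) ℂ} (hg : g ∈ CliffordGroup n) (φ : FixAut n)
    {v w : Fin n → ZMod 2 × ZMod 2} (h : g.val * autOp φ v = pauliOp w * g.val) :
    autOp (cliffordConj n ⟨g, hg⟩ * φ) v = pauliOp w := by
  have : autOp (cliffordConj n ⟨g, hg⟩ * φ) v = g.val * autOp φ v * g⁻¹.val := rfl
  rw [this, h, mul_assoc, Units.mul_inv, mul_one]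

/-- Anticommuting Pauli operators are conjugate under the Clifford group. -/
lemma exists_clifford_conj_of_anticommute {q q' : Fin n → ZMod 2 × ZMod 2}
    (h : qubitsForm q q' = 1) {M : Matrix (Fin (2 ^ n)) (Fin (2 ^ n)) ℂ}
    (hM : M = pauliOp q ∨ M = -pauliOp q) :
    ∃ g ∈ CliffordGroup n, g.val * M = pauliOp q' * g.val ∧
      ∀ r, qubitsForm (q + q') r = 0 → g.val * pauliOp r = pauliOp r * g.val := by
  set P := pauliOp (q + q') with hPdef
  have hP : P * P = 1 := pauliOp_mul_self _
  have hanti : P * pauliOp q = -(pauliOp q * P) := by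
    rw [hPdef, pauliOp_comm, qubitsForm_add_left, qubitsForm_self, qubitsForm_symm, h, zero_add,
      parity_one, neg_one_smul]
  have hanti' : -P * pauliOp q = -(pauliOp q * -P) := by rw [neg_mul, hanti, mul_neg]
  have hP' : -P * -P = 1 := by rw [neg_mul_neg, hP]
  have hcomm : ∀ r, qubitsForm (q + q') r = 0 → P * pauliOp r = pauliOp r * P := fun r hr => by
    rw [hPdef, pauliOp_comm, hr, parity_zero, one_smul]
  have hcomm' : ∀ r, qubitsForm (q + q') r = 0 → -P * pauliOp r = pauliOp r * -P := fun r hr => by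
    rw [neg_mul, hcomm r hr, mul_neg]
  have hsign : Complex.I • (P * pauliOp q) = pauliOp q' ∨
      Complex.I • (P * pauliOp q) = -pauliOp q' := by
    obtain ⟨c, -, hc⟩ := exists_pauliOp_mul (q + q') q
    have hsq := I_smul_mul_mul_self hP (pauliOp_mul_self q) hanti
    rw [hc, smul_smul, add_comm q, add_add_cancel_of_zmod_two] at hsq ⊢
    rcases eq_one_or_eq_neg_one_of_smul_pauliOp hsq with h1 | h1 <;> simp [h1]
  have hplus : (rotUnit (q + q')).val * pauliOp q =
      Complex.I • (P * pauliOp q) * (rotUnit (q + q')).val := pauliRot_mul_of_anticommute hP hanti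
  have hminus : (rotUnit (q + q'))⁻¹.val * pauliOp q =
      Complex.I • (-P * pauliOp q) * (rotUnit (q + q'))⁻¹.val :=
    pauliRot_mul_of_anticommute hP' hanti'
  rw [neg_mul, smul_neg] at hminus
  have hmem := rotUnit_mem_cliffordGroup (q + q')
  rcases hsign with hs | hs <;> rcases hM with rfl | rfl <;> rw [hs] at hplus hminus
  · exact ⟨_, hmem, hplus, fun r hr => pauliRot_mul_of_commute (hcomm r hr)⟩
  · exact ⟨_, inv_mem hmem, by rw [mul_neg, hminus, neg_mul, neg_neg],
      fun r hr => pauliRot_mul_of_commute (hcomm' r hr)⟩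
  · exact ⟨_, inv_mem hmem, by rw [hminus, neg_neg],
      fun r hr => pauliRot_mul_of_commute (hcomm' r hr)⟩
  · exact ⟨_, hmem, by rw [mul_neg, hplus, neg_mul, neg_neg],
      fun r hr => pauliRot_mul_of_commute (hcomm r hr)⟩

lemma exists_autOp_eq_of_anticommute (φ : FixAut n) {v q q' : Fin n → ZMod 2 × ZMod 2}
    (hv : autOp φ v = pauliOp q ∨ autOp φ v = -pauliOp q) (h : qubitsForm q q' = 1) :
    ∃ C, autOp (cliffordConj n C * φ) v = pauliOp q' ∧ ∀ r, autOp φ r = pauliOp r →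
      qubitsForm (q + q') r = 0 → autOp (cliffordConj n C * φ) r = pauliOp r := by
  obtain ⟨g, hg, h1, h2⟩ := exists_clifford_conj_of_anticommute h hv
  exact ⟨⟨g, hg⟩, autOp_cliffordConj_mul hg φ h1, fun r hr hr' =>
    autOp_cliffordConj_mul hg φ (by rw [hr, h2 r hr'])⟩

lemma exists_autOp_eq_via (φ : FixAut n) {v q q' : Fin n → ZMod 2 × ZMod 2}
    (d : Fin n → ZMod 2 × ZMod 2) (hv : autOp φ v = pauliOp q ∨ autOp φ v = -pauliOp q)
    (h : qubitsForm q d = 1) (h' : qubitsForm d q' = 1) :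
    ∃ C, autOp (cliffordConj n C * φ) v = pauliOp q' ∧ ∀ r, autOp φ r = pauliOp r →
      qubitsForm (q + d) r = 0 → qubitsForm (d + q') r = 0 →
        autOp (cliffordConj n C * φ) r = pauliOp r := by
  obtain ⟨C, hC, hC'⟩ := exists_autOp_eq_of_anticommute φ hv h
  obtain ⟨D, hD, hD'⟩ := exists_autOp_eq_of_anticommute _ (Or.inl hC) h'
  refine ⟨D * C, by rwa [map_mul, mul_assoc], fun r hr h1 h2 => ?_⟩
  rw [map_mul, mul_assoc]
  exact hD' r (hC' r hr h1) h2

lemma qubitsForm_eq_zero_of_disjoint {u v : Fin n → ZMod 2 × ZMod 2}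
    (h : ∀ i, u i = 0 ∨ v i = 0) : qubitsForm u v = 0 := by
  refine Finset.sum_eq_zero fun i _ => ?_
  rcases h i with h | h <;> simp [qubitForm, h]

lemma qubitsForm_atQubit_of_le {k : ℕ} {r : Fin n → ZMod 2 × ZMod 2}
    (hr : ∀ i : Fin n, k ≤ i.val → r i = 0) (s : ZMod 2 × ZMod 2) :
    qubitsForm (atQubit n k s) r = 0 :=
  qubitsForm_eq_zero_of_disjoint fun i => by
    rcases eq_or_ne i.val k with h | h
    · exact Or.inr (hr i h.ge)
    · exact Or.inl (atQubit_apply_of_ne h s)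

lemma exists_autOp_atQubit_Z_eq {k : ℕ} (hk : k < n) (φ : FixAut n)
    (hφ : ∀ r : Fin n → ZMod 2 × ZMod 2, (∀ i : Fin n, k ≤ i.val → r i = 0) →
      autOp φ r = pauliOp r) :
    ∃ C, autOp (cliffordConj n C * φ) (atQubit n k (0, 1)) = pauliOp (atQubit n k (0, 1)) ∧
      ∀ r : Fin n → ZMod 2 × ZMod 2, (∀ i : Fin n, k ≤ i.val → r i = 0) →
        autOp (cliffordConj n C * φ) r = pauliOp r := by
  obtain ⟨q, hq⟩ := autOp_eq_or_eq_neg φ (atQubit n k (0, 1))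
  have hqr : ∀ r : Fin n → ZMod 2 × ZMod 2, (∀ i : Fin n, k ≤ i.val → r i = 0) →
      qubitsForm q r = 0 := fun r hr => by
    rw [qubitsForm_eq_of_autOp hq (Or.inl (hφ r hr)), qubitsForm_atQubit_of_le hr]
  have hlow : ∀ i : Fin n, i.val < k → q i = 0 := by
    intro i hi
    by_contra hne
    obtain ⟨t, -, ht⟩ := exists_qubitForm_eq_one hne
    have := hqr (atQubit n i t) fun j hj => atQubit_apply_of_ne (by omega) t
    rw [qubitsForm_atQubit _ i.2, ht] at this
    exact one_ne_zero this
  obtain ⟨l, hl⟩ : ∃ l, q l ≠ 0 := by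
    by_contra! h0
    obtain ⟨w, hw⟩ := autOp_eq_or_eq_neg φ (atQubit n k (1, 0))
    have := qubitsForm_eq_of_autOp hq hw
    rw [qubitsForm_eq_zero_of_disjoint fun i => Or.inl (h0 i), qubitsForm_atQubit _ hk,
      atQubit_apply_self] at this
    exact absurd this (by decide)
  obtain ⟨d, hd, hd', hdr⟩ : ∃ d, qubitsForm q d = 1 ∧ qubitsForm d (atQubit n k (0, 1)) = 1 ∧
      ∀ r : Fin n → ZMod 2 × ZMod 2, (∀ i : Fin n, k ≤ i.val → r i = 0) →
        qubitsForm d r = 0 := by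
    by_cases hqk : q ⟨k, hk⟩ = 0
    · obtain ⟨t, -, ht⟩ := exists_qubitForm_eq_one hl
      have hne : l ≠ ⟨k, hk⟩ := fun h => hl (h ▸ hqk)
      have hkl : k ≠ l.val := fun h => hne (Fin.ext h.symm)
      have hle : k ≤ l.val := not_lt.1 fun h => hl (hlow l h)
      refine ⟨atQubit n k (1, 0) + atQubit n l t, ?_, ?_, fun r hr => ?_⟩
      · rw [qubitsForm_add_right, qubitsForm_atQubit _ hk, qubitsForm_atQubit _ l.2, hqk, ht]
        simp [qubitForm]
      · rw [qubitsForm_atQubit _ hk, Pi.add_apply, atQubit_apply_self, atQubit_apply_of_ne hkl]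
        decide
      · rw [qubitsForm_add_left, qubitsForm_atQubit_of_le hr,
          qubitsForm_atQubit_of_le fun i hi => hr i (hle.trans hi), add_zero]
    · have key : ∀ s : ZMod 2 × ZMod 2, s ≠ 0 →
          ∃ t, qubitForm s t = 1 ∧ qubitForm t (0, 1) = 1 := by decide
      obtain ⟨t, ht, ht'⟩ := key _ hqk
      refine ⟨atQubit n k t, ?_, ?_, fun r hr => qubitsForm_atQubit_of_le hr t⟩
      · rw [qubitsForm_atQubit _ hk, ht]
      · rw [qubitsForm_atQubit _ hk, atQubit_apply_self, ht']
  obtain ⟨C, hC, hC'⟩ := exists_autOp_eq_via φ d hq hd hd'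
  refine ⟨C, hC, fun r hr => hC' r (hφ r hr) ?_ ?_⟩
  · rw [qubitsForm_add_left, hqr r hr, hdr r hr, add_zero]
  · rw [qubitsForm_add_left, hdr r hr, qubitsForm_atQubit_of_le hr, add_zero]

lemma exists_autOp_atQubit_X_eq {k : ℕ} (hk : k < n) (φ : FixAut n)
    (hφ : ∀ r : Fin n → ZMod 2 × ZMod 2, (∀ i : Fin n, k ≤ i.val → r i = 0) →
      autOp φ r = pauliOp r)
    (hZ : autOp φ (atQubit n k (0, 1)) = pauliOp (atQubit n k (0, 1))) :
    ∃ C, autOp (cliffordConj n C * φ) (atQubit n k (1, 0)) = pauliOp (atQubit n k (1, 0)) ∧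
      autOp (cliffordConj n C * φ) (atQubit n k (0, 1)) = pauliOp (atQubit n k (0, 1)) ∧
      ∀ r : Fin n → ZMod 2 × ZMod 2, (∀ i : Fin n, k ≤ i.val → r i = 0) →
        autOp (cliffordConj n C * φ) r = pauliOp r := by
  obtain ⟨q, hq⟩ := autOp_eq_or_eq_neg φ (atQubit n k (1, 0))
  have hXZ : qubitsForm (atQubit n k (1, 0)) (atQubit n k (0, 1)) = 1 := by
    rw [qubitsForm_atQubit _ hk, atQubit_apply_self]
    decide
  have hqZ : qubitsForm q (atQubit n k (0, 1)) = 1 := by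
    rw [qubitsForm_eq_of_autOp hq (Or.inl hZ), hXZ]
  have hqr : ∀ r : Fin n → ZMod 2 × ZMod 2, (∀ i : Fin n, k ≤ i.val → r i = 0) →
      qubitsForm q r = 0 := fun r hr => by
    rw [qubitsForm_eq_of_autOp hq (Or.inl (hφ r hr)), qubitsForm_atQubit_of_le hr]
  have htwo : (1 + 1 : ZMod 2) = 0 := rfl
  rcases zmod_two_eq (qubitsForm q (atQubit n k (1, 0))) with h | h
  · obtain ⟨C, hC, hC'⟩ := exists_autOp_eq_via φ (q' := atQubit n k (1, 0))
      (q + atQubit n k (0, 1)) hq (by rw [qubitsForm_add_right, qubitsForm_self, hqZ, zero_add])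
      (by rw [qubitsForm_add_left, h, qubitsForm_symm, hXZ, zero_add])
    refine ⟨C, hC, hC' _ hZ ?_ ?_, fun r hr => hC' r (hφ r hr) ?_ ?_⟩
    · simp [qubitsForm_add_left, qubitsForm_self, hqZ, htwo]
    · simp [qubitsForm_add_left, qubitsForm_self, hqZ, hXZ, htwo]
    · simp [qubitsForm_add_left, hqr r hr, qubitsForm_atQubit_of_le hr]
    · simp [qubitsForm_add_left, hqr r hr, qubitsForm_atQubit_of_le hr]
  · obtain ⟨C, hC, hC'⟩ := exists_autOp_eq_of_anticommute φ hq h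
    refine ⟨C, hC, hC' _ hZ ?_, fun r hr => hC' r (hφ r hr) ?_⟩
    · simp [qubitsForm_add_left, hqZ, hXZ, htwo]
    · simp [qubitsForm_add_left, hqr r hr, qubitsForm_atQubit_of_le hr]

lemma exists_cliffordConj_mul_fixes (φ : FixAut n) {k : ℕ} (hk : k ≤ n) :
    ∃ C, ∀ r : Fin n → ZMod 2 × ZMod 2, (∀ i : Fin n, k ≤ i.val → r i = 0) →
      autOp (cliffordConj n C * φ) r = pauliOp r := by
  induction k with
  | zero =>
    refine ⟨1, fun r hr => ?_⟩
    rw [show r = 0 from funext fun i => hr i (Nat.zero_le _), map_one, one_mul, pauliOp_zero]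
    have h1 : pauliElem (0 : Fin n → ZMod 2 × ZMod 2) = 1 :=
      Subtype.ext (Units.ext pauliOp_zero)
    rw [autOp, h1, map_one]
    rfl
  | succ k ih =>
    obtain ⟨C, hC⟩ := ih (by omega)
    obtain ⟨D, hDZ, hD⟩ := exists_autOp_atQubit_Z_eq hk _ hC
    obtain ⟨E, hEX, hEZ, hE⟩ := exists_autOp_atQubit_X_eq hk _ hD hDZ
    refine ⟨E * (D * C), fun r hr => ?_⟩
    rw [map_mul, map_mul, mul_assoc, mul_assoc]
    have hat : ∀ s, autOp (cliffordConj n E * (cliffordConj n D * (cliffordConj n C * φ)))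
        (atQubit n k s) = pauliOp (atQubit n k s) := by
      intro s
      have hs : s = 0 ∨ s = (1, 0) ∨ s = (0, 1) ∨ s = (1, 0) + (0, 1) := by decide +revert
      rcases hs with rfl | rfl | rfl | rfl
      · rw [atQubit_zero]
        exact hE 0 fun i _ => rfl
      · exact hEX
      · exact hEZ
      · rw [← atQubit_add]
        exact autOp_add hEX hEZ
    rw [← add_add_cancel_of_zmod_two r (atQubit n k (r ⟨k, hk⟩))]
    refine autOp_add (hE _ fun i hi => ?_) (hat _)
    rcases hi.eq_or_lt with h | h
    · rw [show i = ⟨k, hk⟩ from Fin.ext h.symm, Pi.add_apply, atQubit_apply_self]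
      generalize r ⟨k, hk⟩ = s
      decide +revert
    · rw [Pi.add_apply, hr i h, atQubit_apply_of_ne h.ne', add_zero]

theorem cliffordConj_surjective (n : ℕ) : Function.Surjective (cliffordConj n) := by
  intro φ
  obtain ⟨C, hC⟩ := exists_cliffordConj_mul_fixes φ le_rfl
  have h := eq_one_of_autOp fun v => hC v fun i hi => absurd i.2 (by omega)
  exact ⟨C⁻¹, by rw [map_inv, inv_eq_of_mul_eq_one_right h]⟩

/-- The quotient of the Clifford group by its subgroup of scalar
matrices {ωᵏ·I : 0 ≤ k < 8} is isomorphic to the group of scalar-fixing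
automorphisms of the Pauli group, via the map sending (the class of) C to the
automorphism P ↦ C P C⁻¹. -/
theorem clifford_mod_scalars_iso_aut (n : ℕ) :
    ∃ e : (CliffordGroup n ⧸ CliffordScalars n) ≃* FixAut n,
      ∀ (C : CliffordGroup n) (u : PauliGroup n),
        ((((e (QuotientGroup.mk C) : MulAut (PauliGroup n)) u : PauliGroup n)
            : GL (Fin (2 ^ n)) ℂ)
          = (C : GL (Fin (2 ^ n)) ℂ) * (u : GL (Fin (2 ^ n)) ℂ) *
              (C : GL (Fin (2 ^ n)) ℂ)⁻¹) := by
  refine ⟨(QuotientGroup.quotientMulEquivOfEq (ker_cliffordConj n).symm).trans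
    (QuotientGroup.quotientKerEquivOfSurjective _ (cliffordConj_surjective n)), fun C u => ?_⟩
  exact coe_cliffordConj_apply C u
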